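/- Let k be a positive odd integer and m = Σ_{−j≤i≤j} m_{i,j}⟨i,j⟩ a θ-restricted multisegment. Then in Ṽ_θ(0): f_{−k}·P_θ(m)φ̃ = Σ_{ℓ>k} [m_{−k,ℓ}+1] q^{Σ_{ℓ'>ℓ}(m_{−k+2,ℓ'}−m_{−k,ℓ'})} P_θ(m − ⟨−k+2,ℓ⟩ + ⟨−k,ℓ⟩)φ̃ + [2m_{−k,k}+2] q^{Σ_{ℓ'>k}(m_{−k+2,ℓ'}−m_{−k,ℓ'})} P_θ(m − ⟨−k+2,k⟩ + ⟨−k,k⟩)φ̃ + [m_{−k+2,k}+1] q^{Σ_{ℓ'>k}(m_{−k+2,ℓ'}−m_{−k,ℓ'}) + m_{−k+2,k} − 2m_{−k,k}} P_θ(m − δ_{k≠1}⟨−k+2,k−2⟩ + ⟨−k+2,k⟩)φ̃ + Σ_{−k+2<i≤k} [m_{i,k}+1] q^{Σ_{ℓ'>k}(m_{−k+2,ℓ'}−m_{−k,ℓ'}) + 2m_{−k+2,k−2} − 2m_{−k,k} + Σ_{−k+2<j<i}(m_{j,k−2}−m_{j,k})} P_θ(m − δ_{i≠k}⟨i,k−2⟩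 + ⟨i,k⟩)φ̃, where all summation indices run over odd integers. -/

import Mathlib

/-! Basic setup: `K = ℚ(q)` and the algebra `U_q^-(gl_∞)`. -/

noncomputable section

/-- The base field `K = ℚ(q)`. -/
abbrev K : Type := RatFunc ℚ

/-- The indeterminate `q`. -/
def q : K := RatFunc.X

/-- The `q`-integer `[n]`. -/
def qint (n : ℤ) : K := (q ^ n - q ^ (-n)) / (q - q⁻¹)

/-- The `q`-factorial `[n]!`. -/
def qfact (n : ℕ) : K := ∏ k ∈ Finset.range n, qint (k + 1)

/-- The `q`-Serre relations defining `U_q^-(gl_∞)`; the generator indexed by `a : ℤ`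
corresponds to `f_i` for the odd integer `i = 2a+1`, so that `|i - j| > 2 ↔ 1 < |a - b|`
and `|i - j| = 2 ↔ |a - b| = 1`. -/
inductive URel : FreeAlgebra K ℤ → FreeAlgebra K ℤ → Prop
  | far (a b : ℤ) (h : 1 < |a - b|) :
      URel (FreeAlgebra.ι K a * FreeAlgebra.ι K b) (FreeAlgebra.ι K b * FreeAlgebra.ι K a)
  | serre (a b : ℤ) (h : |a - b| = 1) :
      URel (FreeAlgebra.ι K a * FreeAlgebra.ι K a * FreeAlgebra.ι K b
            + FreeAlgebra.ι K b * (FreeAlgebra.ι K a * FreeAlgebra.ι K a))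
           ((q + q⁻¹) • (FreeAlgebra.ι K a * FreeAlgebra.ι K b * FreeAlgebra.ι K a))

/-- The algebra `U_q^-(gl_∞)`. -/
abbrev U : Type := RingQuot URel

/-- The generator `f_i` of `U_q^-(gl_∞)`, for an odd integer `i`. -/
def fgen (i : ℤ) : U := RingQuot.mkAlgHom K URel (FreeAlgebra.ι K ((i - 1) / 2))

/-- `segAux i n` is the segment `⟨i, i+2n⟩`. -/
def segAux (i : ℤ) : ℕ → U
  | 0 => fgen i
  | n + 1 => segAux i n * fgen (i + 2 * (n + 1)) - q • (fgen (i + 2 * (n + 1)) * segAux i n)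

/-- The segment `⟨i,j⟩ ∈ U_q^-(gl_∞)` for odd `i ≤ j`. -/
def seg (i j : ℤ) : U := segAux i ((j - i) / 2).toNat

/-- The divided power `⟨i,j⟩^{(n)}` (zero for `n < 0`). -/
def segPow (i j : ℤ) (n : ℤ) : U :=
  if n < 0 then 0 else (qfact n.toNat)⁻¹ • seg i j ^ n.toNat

/-- The modified divided power `⟨i,j⟩^{[n]}`. -/
def segPowM (i j : ℤ) (n : ℤ) : U :=
  if i = -j then
    (if n < 0 then 0 else (∏ ν ∈ Finset.range n.toNat, qint (2 * (ν + 1)))⁻¹ • seg i j ^ n.toNat)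
  else segPow i j n


open scoped Classical

/-- Multisegments as elements of the free abelian group on the segments `⟨i,j⟩`. -/
abbrev MS : Type := (ℤ × ℤ) →₀ ℤ

/-- The segment `⟨i,j⟩` viewed as a multisegment. -/
def sg (i j : ℤ) : MS := Finsupp.single (i, j) 1

/-- `m` is a multisegment: supported on pairs of odd integers `i ≤ j`,
with nonnegative multiplicities. -/
def IsMulti (m : MS) : Prop :=
  ∀ i j : ℤ, m (i, j) ≠ 0 → Odd i ∧ Odd j ∧ i ≤ j ∧ 0 < m (i, j)

/-- `m` is a θ-restricted multisegment (`m_{i,j} = 0` unless `−j ≤ i ≤ j`). -/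
def IsTheta (m : MS) : Prop :=
  ∀ i j : ℤ, m (i, j) ≠ 0 → Odd i ∧ Odd j ∧ -j ≤ i ∧ i ≤ j ∧ 0 < m (i, j)

/-- The pairs `(i,j)` in the box `[-N,N]²`, listed in decreasing PBW order,
i.e. decreasing lexicographic order in `(j,i)`. -/
def box (N : ℕ) : List (ℤ × ℤ) :=
  (List.range (2 * N + 1)).flatMap fun a =>
    (List.range (2 * N + 1)).map fun b => (((N : ℤ) - b, (N : ℤ) - a))

/-- A bound on the support of `m`. -/
def bound (m : MS) : ℕ := m.support.sup fun p => max p.1.natAbs p.2.natAbs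

/-- The product of the modified divided powers `⟨i,j⟩^{[m_{i,j}]}` over the segments
appearing in `m`, in decreasing PBW order. -/
def PthetaProd (m : MS) : U := ((box (bound m)).map fun p => segPowM p.1 p.2 (m p)).prod

/-- `P_θ(m)` for a θ-restricted multisegment `m`; it is `0` if `m` is not a
θ-restricted multisegment. -/
def Ptheta (m : MS) : U := if IsTheta m then PthetaProd m else 0

/-- The left ideal `Σ_k U_q^-(gl_∞)(f_k − f_{−k})` (over odd `k`). -/
def Jideal : Ideal U := Ideal.span {x : U | ∃ k : ℤ, Odd k ∧ x = fgen k - fgen (-k)}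

/-- The quotient module `Ṽ_θ(0)`. -/
abbrev Vt : Type := U ⧸ Jideal

/-- The generator `φ̃ ∈ Ṽ_θ(0)`, image of `1`. -/
def phi : Vt := Submodule.Quotient.mk 1

section QSegments

variable {F A : Type*} [Field F] [Ring A] [Algebra F A]

/-- The `q`-commutator `xy - q yx`. -/
def qcomm (c : F) (x y : A) : A := x * y - c • (y * x)

/-- Elements `x` and `y` satisfy `xy = c yx`. -/
def QCommute (c : F) (x y : A) : Prop := x * y = c • (y * x)

theorem QCommute.of_commute {x y : A} (h : Commute x y) : QCommute (1 : F) x y := by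
  rw [QCommute, one_smul]; exact h

theorem QCommute.commute {x y : A} (h : QCommute (1 : F) x y) : Commute x y := by
  rw [QCommute, one_smul] at h; exact h

theorem QCommute.mul_right {c d : F} {x y z : A} (hy : QCommute c x y) (hz : QCommute d x z) :
    QCommute (c * d) x (y * z) := by
  unfold QCommute at *
  rw [← mul_assoc, hy, smul_mul_assoc, mul_assoc, hz, mul_smul_comm, smul_smul, mul_assoc]

theorem QCommute.mul_left {c d : F} {x y z : A} (hx : QCommute c x z) (hy : QCommute d y z) :
    QCommute (c * d) (x * y) z := by
  unfold QCommute at *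
  rw [mul_assoc, hy, mul_smul_comm, ← mul_assoc, hx, smul_mul_assoc, smul_smul, mul_assoc,
    mul_comm]

theorem QCommute.smul_right {c : F} {x y : A} (h : QCommute c x y) (d : F) :
    QCommute c x (d • y) := by
  unfold QCommute at *
  rw [mul_smul_comm, h, smul_mul_assoc, smul_comm]

theorem QCommute.qcomm_right {c d e : F} {x y z : A} (hy : QCommute c x y)
    (hz : QCommute d x z) : QCommute (c * d) x (qcomm e y z) := by
  have h1 := hy.mul_right hz
  have h2 := (hz.mul_right hy).smul_right e
  rw [mul_comm d c] at h2
  unfold qcomm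
  unfold QCommute at *
  rw [mul_sub, h1, h2, sub_mul, smul_sub]

theorem QCommute.qcomm_left {c d e : F} {x y z : A} (hx : QCommute c x z)
    (hy : QCommute d y z) : QCommute (c * d) (qcomm e x y) z := by
  have h1 := hx.mul_left hy
  have h2 := hy.mul_left hx
  unfold qcomm
  unfold QCommute at *
  rw [sub_mul, h1, smul_mul_assoc, h2, mul_sub, mul_smul_comm, smul_sub, smul_comm e, mul_comm d c]

theorem QCommute.pow_right {c : F} {x y : A} (h : QCommute c x y) (n : ℕ) :
    QCommute (c ^ n) x (y ^ n) := by
  induction n with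
  | zero => simp [QCommute]
  | succ n ih => rw [pow_succ, pow_succ]; exact ih.mul_right h

theorem QCommute.symm {c : F} (hc : c ≠ 0) {x y : A} (h : QCommute c x y) :
    QCommute c⁻¹ y x := by
  unfold QCommute at *
  rw [h, smul_smul, inv_mul_cancel₀ hc, one_smul]

theorem qcomm_qcomm_of_commute {c : F} {x y z : A} (h : Commute x z) :
    qcomm c (qcomm c x y) z = qcomm c x (qcomm c y z) := by
  have h' : x * z = z * x := h
  simp only [qcomm, sub_mul, mul_sub, smul_sub, smul_mul_assoc, mul_smul_comm, mul_assoc, h']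
  rw [← mul_assoc z x y, ← h', mul_assoc]
  abel

/-- The quantum Serre relations for a family of generators of type `A_∞`. -/
structure SerreFamily (c : F) (f : ℤ → A) : Prop where
  ne_zero : c ≠ 0
  sq_add_one_ne_zero : c ^ 2 + 1 ≠ 0
  far : ∀ a b, 1 < |a - b| → Commute (f a) (f b)
  serre : ∀ a b, |a - b| = 1 →
    f a * f a * f b + f b * (f a * f a) = (c + c⁻¹) • (f a * f b * f a)

/-- The iterated `q`-commutator of `f a, …, f (a + n)`. -/
def qseg (c : F) (f : ℤ → A) (a : ℤ) : ℕ → A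
  | 0 => f a
  | n + 1 => qcomm c (qseg c f a n) (f (a + n + 1))

namespace SerreFamily

variable {c : F} {f : ℤ → A}

theorem commute_qseg {x : A} {a : ℤ} {n : ℕ} (h : ∀ b, a ≤ b → b ≤ a + n → Commute x (f b)) :
    Commute x (qseg c f a n) := by
  induction n with
  | zero => exact h a le_rfl (by simp)
  | succ n ih =>
    have h1 := ih fun b h1 h2 => h b h1 (by push_cast; omega)
    have h2 := h (a + n + 1) (by omega) (by push_cast; omega)
    have h3 := (QCommute.of_commute (F := F) h1).qcomm_right (e := c) (QCommute.of_commute h2)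
    rw [one_mul] at h3
    exact h3.commute

theorem commute_gen_qseg (hf : SerreFamily c f) {a b : ℤ} {n : ℕ}
    (h : b + 1 < a ∨ a + n + 1 < b) : Commute (f b) (qseg c f a n) := by
  refine commute_qseg fun d h1 h2 => hf.far _ _ ?_
  rw [lt_abs]; omega

theorem qseg_concat (hf : SerreFamily c f) (a : ℤ) (n m : ℕ) :
    qseg c f a (n + m + 1) = qcomm c (qseg c f a n) (qseg c f (a + n + 1) m) := by
  induction m with
  | zero => rfl
  | succ m ih =>
    change qcomm c (qseg c f a (n + m + 1)) (f (a + (n + m + 1 : ℕ) + 1)) =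
      qcomm c _ (qcomm c (qseg c f (a + n + 1) m) (f (a + n + 1 + m + 1)))
    rw [ih, qcomm_qcomm_of_commute]
    · congr 3; push_cast; ring
    · exact (hf.commute_gen_qseg (Or.inr (by push_cast; omega))).symm

theorem qseg_succ_left (hf : SerreFamily c f) (a : ℤ) (n : ℕ) :
    qseg c f a (n + 1) = qcomm c (f a) (qseg c f (a + 1) n) := by
  have := hf.qseg_concat a 0 n
  rw [zero_add] at this
  simpa [qseg] using this

theorem gen_qcomm (hf : SerreFamily c f) (a b : ℤ) (h : |a - b| = 1) :
    QCommute c⁻¹ (f a) (qcomm c (f a) (f b)) := by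
  have h1 := hf.serre a b h
  have hc := hf.ne_zero
  rw [add_smul] at h1
  simp only [QCommute, qcomm, mul_sub, sub_mul, smul_sub, smul_smul, mul_smul_comm,
    smul_mul_assoc, inv_mul_cancel₀ hc, one_smul, ← mul_assoc] at h1 ⊢
  rw [eq_comm, ← sub_eq_zero] at h1 ⊢
  rw [← h1]; abel

theorem qcomm_gen (hf : SerreFamily c f) (a b : ℤ) (h : |a - b| = 1) :
    QCommute c⁻¹ (qcomm c (f a) (f b)) (f b) := by
  have h1 := hf.serre b a (by rw [abs_sub_comm]; exact h)
  have hc := hf.ne_zero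
  rw [add_smul] at h1
  simp only [QCommute, qcomm, mul_sub, sub_mul, smul_sub, smul_smul, mul_smul_comm,
    smul_mul_assoc, inv_mul_cancel₀ hc, one_smul, ← mul_assoc] at h1 ⊢
  rw [eq_comm, ← sub_eq_zero] at h1 ⊢
  rw [← h1]; abel

theorem gen_qseg_left (hf : SerreFamily c f) (a : ℤ) (n : ℕ) :
    QCommute c⁻¹ (f a) (qseg c f a (n + 1)) := by
  have h1 : QCommute c⁻¹ (f a) (qseg c f a 1) := by
    have := hf.gen_qcomm a (a + 1) (by simp)
    simpa [qseg] using this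
  rcases n with _ | n
  · exact h1
  · have h2 := hf.qseg_concat a 1 n
    rw [show n + 1 + 1 = 1 + n + 1 by ring, h2, ← mul_one c⁻¹]
    exact h1.qcomm_right (.of_commute (hf.commute_gen_qseg (Or.inl (by push_cast; omega))))

theorem qseg_gen_right (hf : SerreFamily c f) (a : ℤ) (n : ℕ) :
    QCommute c⁻¹ (qseg c f a (n + 1)) (f (a + n + 1)) := by
  have h1 : QCommute c⁻¹ (qseg c f (a + n) 1) (f (a + n + 1)) := by
    have := hf.qcomm_gen (a + n) (a + n + 1) (by simp)
    simpa [qseg] using this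
  rcases n with _ | n
  · simpa using h1
  · have h2 := hf.qseg_concat a n 1
    rw [h2, ← one_mul c⁻¹]
    refine QCommute.qcomm_left
      (.of_commute (hf.commute_gen_qseg (Or.inr (by push_cast; omega))).symm) ?_
    rw [show a + ((n + 1 : ℕ) : ℤ) = a + n + 1 by push_cast; ring] at h1
    rwa [show a + ((n + 1 : ℕ) : ℤ) = a + n + 1 by push_cast; ring]

theorem commute_gen_qseg_two (hf : SerreFamily c f) (a : ℤ) :
    Commute (f (a + 1)) (qseg c f a 2) := by
  have hc := hf.ne_zero
  set x := f a
  set y := f (a + 1) with hy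
  set z := f (a + 2) with hz
  have hT : qseg c f a 2 = qcomm c (qcomm c x y) z := by
    simp [qseg, x, y, z, add_assoc, one_add_one_eq_two]
  have hA : QCommute c⁻¹ (qcomm c x y) y := hf.qcomm_gen a (a + 1) (by simp)
  have hB : QCommute c⁻¹ y (qcomm c y z) := by
    have := hf.gen_qcomm (a + 1) (a + 2) (by simp)
    exact this
  have hxz : Commute x z := hf.far a (a + 2) (by simp)
  have hT' := hT.trans (qcomm_qcomm_of_commute hxz)
  rw [Commute, SemiconjBy]
  rw [hT'] at hT ⊢
  set A := qcomm c x y with hAdef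
  set B := qcomm c y z with hBdef
  set T := qcomm c x B with hTdef
  have e1 : c • (y * x) = x * y - A := by rw [hAdef, qcomm]; abel
  have e2 : c • (z * y) = y * z - B := by rw [hBdef, qcomm]; abel
  have hA' : c • (A * y) = y * A := by rw [hA, smul_smul, mul_inv_cancel₀ hc, one_smul]
  have hB' : c • (y * B) = B * y := by rw [hB, smul_smul, mul_inv_cancel₀ hc, one_smul]
  have t1 : c ^ 2 • (y * T) = T * y + c • (B * A - A * B) := by
    have : c ^ 2 • (y * T) = c • ((c • (y * x)) * B) - c • (c • (y * B)) * (c • x) := by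
      rw [hTdef, qcomm]
      simp only [mul_sub, smul_sub, mul_smul_comm, smul_mul_assoc, smul_smul, mul_assoc, pow_two]
    rw [this, e1, hB', hTdef, qcomm, sub_mul, mul_assoc x y B, smul_sub, ← mul_smul_comm c x,
      hB', smul_mul_assoc, mul_smul_comm, mul_assoc B y x, ← mul_smul_comm c B (y * x), e1]
    simp only [mul_sub, sub_mul, smul_sub, mul_assoc, smul_mul_assoc]
    abel
  have t2 : c ^ 2 • (T * y) = y * T + c • (B * A - A * B) := by
    have : c ^ 2 • (T * y) = c • (A * (c • (z * y))) - c • ((c • z) * (c • (A * y))) := by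
      rw [hT, qcomm]
      simp only [sub_mul, smul_sub, mul_smul_comm, smul_mul_assoc, smul_smul, mul_assoc, pow_two]
    rw [this, e2, hA', hT, qcomm, mul_sub, ← mul_assoc A y z, smul_sub, ← smul_mul_assoc c (A * y),
      hA', smul_mul_assoc, ← mul_assoc z y A, ← smul_mul_assoc c (z * y), e2]
    simp only [mul_sub, sub_mul, smul_sub, mul_assoc, mul_smul_comm]
    abel
  have t3 : (c ^ 2 + 1) • (y * T - T * y) = 0 := by
    rw [add_smul, one_smul, smul_sub, t1, t2]; abel
  exact sub_eq_zero.mp ((smul_eq_zero.mp t3).resolve_left hf.sq_add_one_ne_zero)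

theorem commute_gen_qseg_inner (hf : SerreFamily c f) {a b : ℤ} {n : ℕ} (h1 : a < b)
    (h2 : b < a + n) : Commute (f b) (qseg c f a n) := by
  have key : ∀ n : ℕ, Commute (f b) (qseg c f (b - 1) (n + 2)) := fun n => by
    have h0 := hf.commute_gen_qseg_two (b - 1)
    rw [sub_add_cancel] at h0
    rcases n with _ | n
    · exact h0
    · rw [show n + 1 + 2 = 2 + n + 1 by ring, hf.qseg_concat]
      refine QCommute.commute (F := F) ?_
      rw [← one_mul (1 : F)]
      exact (QCommute.of_commute h0).qcomm_right
        (.of_commute (hf.commute_gen_qseg (Or.inl (by push_cast; omega))))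
  obtain ⟨m, rfl⟩ : ∃ m : ℕ, b = a + m + 1 := ⟨(b - a - 1).toNat, by omega⟩
  obtain ⟨p, rfl⟩ : ∃ p : ℕ, n = m + p + 2 := ⟨n - m - 2, by omega⟩
  have hk := key p
  rcases m with _ | m
  · simpa [show 0 + p + 2 = p + 2 by ring] using hk
  · rw [show m + 1 + p + 2 = m + (p + 2) + 1 by ring, hf.qseg_concat]
    refine QCommute.commute (F := F) ?_
    rw [← one_mul (1 : F)]
    refine (QCommute.of_commute
      (hf.commute_gen_qseg (Or.inr (by push_cast; omega)))).qcomm_right (.of_commute ?_)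
    rwa [show a + (m + 1 : ℕ) + 1 - 1 = a + m + 1 by push_cast; ring] at hk

theorem qseg_commute_of_nested (hf : SerreFamily c f) {a b : ℤ} {n m : ℕ} (h1 : a < b)
    (h2 : b + m < a + n) : Commute (qseg c f a n) (qseg c f b m) :=
  commute_qseg fun _ hd1 hd2 =>
    (hf.commute_gen_qseg_inner (by omega) (by omega)).symm

theorem qseg_qseg_right (hf : SerreFamily c f) {a b : ℤ} {n m : ℕ} (h1 : a < b)
    (h2 : b + m = a + n) : QCommute c⁻¹ (qseg c f a n) (qseg c f b m) := by
  induction m generalizing b with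
  | zero =>
    obtain ⟨n, rfl⟩ : ∃ p : ℕ, n = p + 1 := ⟨n - 1, by omega⟩
    have := hf.qseg_gen_right a n
    rwa [show a + (n : ℤ) + 1 = b by push_cast at h2; omega] at this
  | succ m ih =>
    rw [hf.qseg_succ_left, ← one_mul c⁻¹]
    push_cast at h2
    exact (QCommute.of_commute (hf.commute_gen_qseg_inner h1 (by omega)).symm).qcomm_right
      (ih (by omega) (by omega))

theorem qseg_qseg_left (hf : SerreFamily c f) (a : ℤ) {n m : ℕ} (h : n < m) :
    QCommute c⁻¹ (qseg c f a n) (qseg c f a m) := by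
  induction n with
  | zero =>
    obtain ⟨p, rfl⟩ : ∃ p : ℕ, m = p + 1 := ⟨m - 1, by omega⟩
    exact hf.gen_qseg_left a p
  | succ n ih =>
    rw [qseg, ← mul_one c⁻¹]
    exact (ih (by omega)).qcomm_left
      (.of_commute (hf.commute_gen_qseg_inner (by omega) (by omega)))

end SerreFamily

end QSegments
section DescendingProducts

/-- The product `g (b - 1) * g (b - 2) * ⋯ * g a`. -/
def descProd {A : Type*} [Monoid A] (g : ℤ → A) (a b : ℤ) : A :=
  ((List.range (b - a).toNat).map fun t : ℕ => g (b - 1 - t)).prod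

section Monoid

variable {A : Type*} [Monoid A] {g h : ℤ → A} {a b : ℤ}

@[simp]
theorem descProd_self (g : ℤ → A) (a : ℤ) : descProd g a a = 1 := by simp [descProd]

theorem descProd_succ (g : ℤ → A) (hab : a ≤ b) :
    descProd g a (b + 1) = g b * descProd g a b := by
  unfold descProd
  rw [show (b + 1 - a).toNat = (b - a).toNat + 1 by omega, List.range_succ_eq_map, List.map_cons,
    List.prod_cons, List.map_map]
  congr 3
  · simp
  · funext t
    simp only [Function.comp_apply]
    congr 1
    push_cast
    ring

theorem descProd_induction {P : ℤ → Prop} (hab : a ≤ b) (base : P a)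
    (step : ∀ c, a ≤ c → c < b → P c → P (c + 1)) : P b := by
  suffices ∀ c, a ≤ c → c ≤ b → P c from this b hab le_rfl
  intro c hc
  induction c, hc using Int.leInduction with
  | base => exact fun _ => base
  | succ c hc ih => exact fun h => step c hc (by omega) (ih (by omega))

theorem descProd_mul_descProd (g : ℤ → A) {c : ℤ} (hab : a ≤ b) (hbc : b ≤ c) :
    descProd g b c * descProd g a b = descProd g a c := by
  refine descProd_induction (P := fun c => descProd g b c * descProd g a b = descProd g a c)
    hbc (by simp) fun c h1 _ ih => ?_
  rw [descProd_succ g h1, descProd_succ g (hab.trans h1), mul_assoc, ih]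

theorem descProd_eq_one (hab : a ≤ b) (h : ∀ i, a ≤ i → i < b → g i = 1) :
    descProd g a b = 1 := by
  refine descProd_induction (P := fun b => descProd g a b = 1) hab (by simp)
    fun c h1 h2 ih => ?_
  rw [descProd_succ g h1, ih, h c h1 h2, one_mul]

theorem descProd_congr (hab : a ≤ b) (H : ∀ i, a ≤ i → i < b → g i = h i) :
    descProd g a b = descProd h a b := by
  refine descProd_induction (P := fun b => descProd g a b = descProd h a b) hab (by simp)
    fun c h1 h2 ih => ?_
  rw [descProd_succ g h1, descProd_succ h h1, ih, H c h1 h2]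

theorem descProd_split (g : ℤ → A) {c : ℤ} (hac : a ≤ c) (hcb : c < b) :
    descProd g a b = descProd g (c + 1) b * g c * descProd g a c := by
  rw [mul_assoc, ← descProd_succ g hac, descProd_mul_descProd g (by omega) (by omega)]

theorem descProd_eq_of_eq_one_outside (g : ℤ → A) {a' b' : ℤ} (h1 : a ≤ a') (h2 : a' ≤ b')
    (h3 : b' ≤ b) (h : ∀ i, a ≤ i → i < b → i < a' ∨ b' ≤ i → g i = 1) :
    descProd g a b = descProd g a' b' := by
  rw [← descProd_mul_descProd g (h1.trans h2) h3, ← descProd_mul_descProd g h1 h2,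
    descProd_eq_one h3 fun i _ _ => h i (by omega) (by omega) (by omega),
    descProd_eq_one h1 fun i _ _ => h i (by omega) (by omega) (by omega), one_mul, mul_one]

theorem commute_descProd {x : A} (hab : a ≤ b) (H : ∀ i, a ≤ i → i < b → Commute x (g i)) :
    Commute x (descProd g a b) := by
  refine descProd_induction (P := fun b => Commute x (descProd g a b)) hab (by simp)
    fun c h1 h2 ih => ?_
  rw [descProd_succ g h1]
  exact (H c h1 h2).mul_right ih

end Monoid

theorem descProd_eq_zero {A : Type*} [MonoidWithZero A] {g : ℤ → A} {a b c : ℤ} (hac : a ≤ c)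
    (hcb : c < b) (h : g c = 0) : descProd g a b = 0 := by
  rw [descProd_split g hac hcb, h, mul_zero, zero_mul]

variable {F A : Type*} [Field F] [Ring A] [Algebra F A] {g h : ℤ → A} {a b : ℤ}

theorem sum_Ico_int_succ {M : Type*} [AddCommMonoid M] (e : ℤ → M) (hab : a ≤ b) :
    ∑ i ∈ Finset.Ico a (b + 1), e i = ∑ i ∈ Finset.Ico a b, e i + e b := by
  rw [← Finset.insert_Ico_right_eq_Ico_add_one hab, Finset.sum_insert Finset.right_notMem_Ico,
    add_comm]

theorem descProd_qcommute {c : F} (hc : c ≠ 0) {e : ℤ → ℤ} {x : A} (hab : a ≤ b)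
    (H : ∀ i, a ≤ i → i < b → QCommute (c ^ e i) (g i) x) :
    QCommute (c ^ ∑ i ∈ Finset.Ico a b, e i) (descProd g a b) x := by
  refine descProd_induction
    (P := fun b => QCommute (c ^ ∑ i ∈ Finset.Ico a b, e i) (descProd g a b) x) hab
    (by simp [QCommute]) fun d h1 h2 ih => ?_
  rw [descProd_succ g h1, sum_Ico_int_succ e h1, add_comm, zpow_add₀ hc]
  exact (H d h1 h2).mul_left ih

/-- Moving `x` from the left to the right of a product, collecting error terms. -/
theorem mul_descProd {c : F} (hc : c ≠ 0) {e : ℤ → ℤ} {x : A} (hab : a ≤ b)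
    (H : ∀ i, a ≤ i → i < b → x * g i = c ^ e i • (g i * x) + h i) :
    x * descProd g a b = c ^ (∑ i ∈ Finset.Ico a b, e i) • (descProd g a b * x) +
      ∑ l ∈ Finset.Ico a b, c ^ (∑ i ∈ Finset.Ico (l + 1) b, e i) •
        (descProd g (l + 1) b * h l * descProd g a l) := by
  refine descProd_induction (P := fun b => x * descProd g a b =
      c ^ (∑ i ∈ Finset.Ico a b, e i) • (descProd g a b * x) +
      ∑ l ∈ Finset.Ico a b, c ^ (∑ i ∈ Finset.Ico (l + 1) b, e i) •
        (descProd g (l + 1) b * h l * descProd g a l)) hab (by simp) fun d h1 h2 ih => ?_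
  have hsum : ∑ l ∈ Finset.Ico a d, c ^ (∑ i ∈ Finset.Ico (l + 1) (d + 1), e i) •
        (descProd g (l + 1) (d + 1) * h l * descProd g a l) =
      c ^ e d • (g d * ∑ l ∈ Finset.Ico a d, c ^ (∑ i ∈ Finset.Ico (l + 1) d, e i) •
        (descProd g (l + 1) d * h l * descProd g a l)) := by
    rw [Finset.mul_sum, Finset.smul_sum]
    refine Finset.sum_congr rfl fun l hl => ?_
    rw [Finset.mem_Ico] at hl
    rw [sum_Ico_int_succ e (by omega), descProd_succ g (by omega), zpow_add₀ hc, mul_smul_comm,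
      smul_smul, mul_comm (c ^ e d)]
    simp only [mul_assoc]
  rw [sum_Ico_int_succ e h1, sum_Ico_int_succ _ h1, hsum, descProd_succ g h1, ← mul_assoc,
    H d h1 h2, add_mul, smul_mul_assoc, mul_assoc, ih, Finset.Ico_self, descProd_self,
    Finset.sum_empty, zpow_zero, one_smul, one_mul, mul_add, smul_add, mul_smul_comm, smul_smul,
    zpow_add₀ hc, mul_comm (c ^ e d), ← mul_assoc (g d) _ x]
  abel

/-- Moving `x` from the right to the left of a product, collecting error terms. -/
theorem descProd_mul {c : F} (hc : c ≠ 0) {e : ℤ → ℤ} {x : A} (hab : a ≤ b)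
    (H : ∀ i, a ≤ i → i < b → g i * x = c ^ e i • (x * g i) + h i) :
    descProd g a b * x = c ^ (∑ i ∈ Finset.Ico a b, e i) • (x * descProd g a b) +
      ∑ l ∈ Finset.Ico a b, c ^ (∑ i ∈ Finset.Ico a l, e i) •
        (descProd g (l + 1) b * h l * descProd g a l) := by
  refine descProd_induction (P := fun b => descProd g a b * x =
      c ^ (∑ i ∈ Finset.Ico a b, e i) • (x * descProd g a b) +
      ∑ l ∈ Finset.Ico a b, c ^ (∑ i ∈ Finset.Ico a l, e i) •
        (descProd g (l + 1) b * h l * descProd g a l)) hab (by simp) fun d h1 h2 ih => ?_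
  have hsum : ∑ l ∈ Finset.Ico a d, c ^ (∑ i ∈ Finset.Ico a l, e i) •
        (descProd g (l + 1) (d + 1) * h l * descProd g a l) =
      g d * ∑ l ∈ Finset.Ico a d, c ^ (∑ i ∈ Finset.Ico a l, e i) •
        (descProd g (l + 1) d * h l * descProd g a l) := by
    rw [Finset.mul_sum]
    refine Finset.sum_congr rfl fun l hl => ?_
    rw [Finset.mem_Ico] at hl
    rw [descProd_succ g (by omega), mul_smul_comm]
    simp only [mul_assoc]
  rw [sum_Ico_int_succ e h1, sum_Ico_int_succ _ h1, hsum, descProd_succ g h1, mul_assoc, ih,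
    mul_add, mul_smul_comm, ← mul_assoc, H d h1 h2, add_mul, smul_add, smul_mul_assoc, smul_smul,
    descProd_self, one_mul, zpow_add₀ hc, mul_assoc]
  abel

end DescendingProducts
section QIntegers

theorem q_ne_zero : q ≠ 0 := RatFunc.X_ne_zero

theorem q_pow_ne_one {n : ℕ} (hn : n ≠ 0) : q ^ n ≠ 1 := by
  have h : q = algebraMap (Polynomial ℚ) K Polynomial.X := RatFunc.algebraMap_X.symm
  rw [h, ← map_pow, ← map_one (algebraMap (Polynomial ℚ) K)]
  intro h'
  have h2 := congrArg Polynomial.natDegree (RatFunc.algebraMap_injective ℚ h')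
  rw [Polynomial.natDegree_X_pow, Polynomial.natDegree_one] at h2
  exact hn h2

theorem q_sub_inv_ne_zero : q - q⁻¹ ≠ 0 := by
  intro h
  refine q_pow_ne_one two_ne_zero ?_
  have h2 := sub_eq_zero.mp h
  rw [pow_two]
  nth_rewrite 2 [h2]
  exact mul_inv_cancel₀ q_ne_zero

theorem qint_ne_zero {n : ℤ} (hn : 0 < n) : qint n ≠ 0 := by
  refine div_ne_zero (fun h => ?_) q_sub_inv_ne_zero
  obtain ⟨m, rfl⟩ := Int.eq_ofNat_of_zero_le hn.le
  have h2 := sub_eq_zero.mp h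
  refine q_pow_ne_one (n := m + m) (by omega) ?_
  rw [pow_add, ← zpow_natCast]
  nth_rewrite 2 [h2]
  rw [← zpow_add₀ q_ne_zero, add_neg_cancel, zpow_zero]

@[simp]
theorem qint_one : qint 1 = 1 := by
  rw [qint, zpow_one, zpow_neg_one, div_self q_sub_inv_ne_zero]

theorem qint_succ (n : ℤ) : qint (n + 1) = q ^ n + q⁻¹ * qint n := by
  have h1 := q_ne_zero
  have h2 := q_sub_inv_ne_zero
  rw [qint, qint, div_eq_iff h2, add_mul, mul_assoc, div_mul_cancel₀ _ h2, neg_add,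
    zpow_add₀ h1, zpow_add₀ h1, zpow_one, zpow_neg_one]
  ring

theorem qint_two_mul (n : ℤ) : qint (2 * n) = (q ^ n + q ^ (-n)) * qint n := by
  rw [qint, qint, mul_div_assoc', two_mul, neg_add, zpow_add₀ q_ne_zero, zpow_add₀ q_ne_zero]
  congr 1
  ring

variable {A : Type*} [Ring A] [Algebra K A] {x y z : A}

theorem mul_pow_of_qcomm (h : x * y = q • (y * x) + z) (hz : QCommute q⁻¹ z y) (n : ℕ) :
    x * y ^ (n + 1) = q ^ (n + 1) • (y ^ (n + 1) * x) + qint (n + 1) • (y ^ n * z) := by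
  unfold QCommute at hz
  induction n with
  | zero => simpa [qint_one] using h
  | succ n ih =>
    rw [pow_succ y (n + 1), ← mul_assoc, ih, add_mul, smul_mul_assoc, mul_assoc, h, mul_add,
      smul_add, mul_smul_comm, smul_smul, smul_mul_assoc, mul_assoc (y ^ n), hz, mul_smul_comm,
      smul_smul, qint_succ ((n + 1 : ℕ) : ℤ), add_smul, ← mul_assoc, ← mul_assoc, ← pow_succ,
      ← pow_succ, ← pow_succ, zpow_natCast, mul_comm q⁻¹]
    push_cast
    abel

theorem pow_mul_of_qcomm (h : y * x = q • (x * y) + z) (hz : QCommute q⁻¹ y z) (n : ℕ) :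
    y ^ (n + 1) * x = q ^ (n + 1) • (x * y ^ (n + 1)) + qint (n + 1) • (z * y ^ n) := by
  unfold QCommute at hz
  induction n with
  | zero => simpa [qint_one] using h
  | succ n ih =>
    rw [pow_succ' y (n + 1), mul_assoc, ih, mul_add, mul_smul_comm, ← mul_assoc, h, add_mul,
      smul_add, smul_mul_assoc, smul_smul, mul_smul_comm, ← mul_assoc y z, hz, smul_mul_assoc,
      smul_smul, qint_succ ((n + 1 : ℕ) : ℤ), add_smul, mul_assoc, mul_assoc, ← pow_succ',
      ← pow_succ', ← pow_succ, zpow_natCast, mul_comm q⁻¹]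
    push_cast
    abel

end QIntegers
section Segments

/-- The generator of `U_q^-(gl_∞)` indexed by an arbitrary integer `a`. -/
def gen (a : ℤ) : U := RingQuot.mkAlgHom K URel (FreeAlgebra.ι K a)

theorem serreFamily_gen : SerreFamily q gen where
  ne_zero := q_ne_zero
  sq_add_one_ne_zero h := by
    refine q_pow_ne_one (n := 4) (by norm_num) ?_
    rw [show q ^ 4 = (q ^ 2) * (q ^ 2) by ring, eq_neg_of_add_eq_zero_left h]
    ring
  far a b h := by
    have := RingQuot.mkAlgHom_rel K (URel.far a b h)
    rwa [map_mul, map_mul] at this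
  serre a b h := by
    have := RingQuot.mkAlgHom_rel K (URel.serre a b h)
    simp only [map_add, map_mul, map_smul] at this
    exact this

theorem segAux_eq_qseg (i : ℤ) (n : ℕ) : segAux i n = qseg q gen ((i - 1) / 2) n := by
  induction n with
  | zero => rfl
  | succ n ih =>
    have h : fgen (i + 2 * (n + 1)) = gen ((i - 1) / 2 + n + 1) := by
      rw [fgen, gen]; congr 2; omega
    rw [segAux, qseg, ih, h, qcomm]

theorem seg_eq_qseg (i j : ℤ) : seg i j = qseg q gen ((i - 1) / 2) ((j - i) / 2).toNat :=
  segAux_eq_qseg _ _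

theorem fgen_eq_gen (i : ℤ) : fgen i = gen ((i - 1) / 2) := rfl

theorem seg_self (i : ℤ) : seg i i = fgen i := by simp [seg, segAux]

variable {i j l : ℤ}

theorem seg_concat (hi : Odd i) (hj : Odd j) (hl : Odd l) (h1 : i ≤ l) (h2 : l < j) :
    seg i j = qcomm q (seg i l) (seg (l + 2) j) := by
  obtain ⟨a, rfl⟩ := hi
  obtain ⟨b, rfl⟩ := hj
  obtain ⟨d, rfl⟩ := hl
  obtain ⟨n, rfl⟩ : ∃ n : ℕ, d = a + n := ⟨(d - a).toNat, by omega⟩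
  obtain ⟨m, rfl⟩ : ∃ m : ℕ, b = a + n + m + 1 := ⟨(b - (a + n) - 1).toNat, by omega⟩
  have := serreFamily_gen.qseg_concat a n m
  rw [seg_eq_qseg, seg_eq_qseg, seg_eq_qseg]
  convert this using 2
  · omega
  · omega
  · congr 1 <;> omega
  · congr 1 <;> omega

theorem seg_left (hi : Odd i) (hj : Odd j) (h : i < j) :
    seg i j = qcomm q (fgen i) (seg (i + 2) j) := by
  rw [seg_concat hi hj hi le_rfl h, seg_self]

theorem seg_right (hi : Odd i) (hj : Odd j) (h : i < j) :
    seg i j = qcomm q (seg i (j - 2)) (fgen j) := by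
  have hj' : Odd (j - 2) := hj.sub_even even_two
  rw [seg_concat hi hj hj' (by obtain ⟨a, rfl⟩ := hi; obtain ⟨b, rfl⟩ := hj; omega) (by omega),
    sub_add_cancel, seg_self]

theorem seg_seg_right {i' : ℤ} (hi : Odd i) (hi' : Odd i') (hj : Odd j) (h1 : i < i')
    (h2 : i' ≤ j) : QCommute q⁻¹ (seg i j) (seg i' j) := by
  obtain ⟨a, rfl⟩ := hi
  obtain ⟨b, rfl⟩ := hj
  obtain ⟨d, rfl⟩ := hi'
  rw [seg_eq_qseg, seg_eq_qseg]
  exact serreFamily_gen.qseg_qseg_right (by omega) (by omega)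

theorem seg_seg_left {j' : ℤ} (hi : Odd i) (hj' : Odd j') (hj : Odd j) (h1 : i ≤ j')
    (h2 : j' < j) : QCommute q⁻¹ (seg i j') (seg i j) := by
  obtain ⟨a, rfl⟩ := hi
  obtain ⟨b, rfl⟩ := hj
  obtain ⟨d, rfl⟩ := hj'
  rw [seg_eq_qseg, seg_eq_qseg]
  exact serreFamily_gen.qseg_qseg_left _ (by omega)

theorem commute_seg_of_nested {i' j' : ℤ} (hi : Odd i) (hi' : Odd i') (hj : Odd j) (hj' : Odd j')
    (h1 : i < i') (h2 : i' ≤ j') (h3 : j' < j) : Commute (seg i j) (seg i' j') := by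
  obtain ⟨a, rfl⟩ := hi
  obtain ⟨b, rfl⟩ := hj
  obtain ⟨d, rfl⟩ := hi'
  obtain ⟨e, rfl⟩ := hj'
  rw [seg_eq_qseg, seg_eq_qseg]
  exact serreFamily_gen.qseg_commute_of_nested (by omega) (by omega)

theorem commute_fgen_seg_of_lt (hl : Odd l) (hi : Odd i) (h : l + 2 < i ∨ j + 2 < l)
    (hj : Odd j) (hij : i ≤ j) : Commute (fgen l) (seg i j) := by
  obtain ⟨a, rfl⟩ := hi
  obtain ⟨b, rfl⟩ := hj
  obtain ⟨d, rfl⟩ := hl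
  rw [seg_eq_qseg, fgen_eq_gen]
  exact serreFamily_gen.commute_gen_qseg (by omega)

theorem commute_fgen_seg_of_inner (hl : Odd l) (hi : Odd i) (hj : Odd j) (h1 : i < l)
    (h2 : l < j) : Commute (fgen l) (seg i j) := by
  rw [← seg_self]
  exact (commute_seg_of_nested hi hl hj hl h1 le_rfl h2).symm

end Segments

section DividedPowers

variable {i j : ℤ}

theorem segPowM_of_neg {n : ℤ} (hn : n < 0) : segPowM i j n = 0 := by
  simp [segPowM, segPow, hn]

@[simp]
theorem segPowM_zero : segPowM i j 0 = 1 := by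
  simp [segPowM, segPow, qfact]

theorem segPowM_natCast (n : ℕ) : segPowM i j n = (if i = -j then
    ∏ ν ∈ Finset.range n, qint (2 * (ν + 1)) else qfact n)⁻¹ • seg i j ^ n := by
  simp only [segPowM, segPow, if_neg (Int.natCast_nonneg n).not_gt, Int.toNat_natCast]
  split <;> rfl

theorem commute_segPowM {x : U} (h : Commute x (seg i j)) (n : ℤ) :
    Commute x (segPowM i j n) := by
  rcases lt_or_ge n 0 with hn | hn
  · rw [segPowM_of_neg hn]; exact Commute.zero_right x
  · obtain ⟨n, rfl⟩ := Int.eq_ofNat_of_zero_le hn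
    rw [segPowM_natCast]
    exact (h.pow_right n).smul_right _

theorem segPowM_qcommute {c : K} {x : U} (h : QCommute c (seg i j) x) (n : ℤ) :
    QCommute (c ^ n) (segPowM i j n) x := by
  rcases lt_or_ge n 0 with hn | hn
  · rw [segPowM_of_neg hn]; simp [QCommute]
  · obtain ⟨n, rfl⟩ := Int.eq_ofNat_of_zero_le hn
    rw [segPowM_natCast, zpow_natCast]
    have key : QCommute (c ^ n) (seg i j ^ n) x := by
      induction n with
      | zero => simp [QCommute]
      | succ n ih => rw [pow_succ c, pow_succ]; exact (ih (by omega)).mul_left h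
    unfold QCommute at *
    rw [smul_mul_assoc, key, mul_smul_comm, smul_comm]

theorem qcommute_segPowM {c : K} {x : U} (h : QCommute c x (seg i j)) (n : ℤ) :
    QCommute (c ^ n) x (segPowM i j n) := by
  rcases lt_or_ge n 0 with hn | hn
  · rw [segPowM_of_neg hn]; simp [QCommute]
  · obtain ⟨n, rfl⟩ := Int.eq_ofNat_of_zero_le hn
    rw [segPowM_natCast, zpow_natCast]
    exact (h.pow_right n).smul_right _

theorem qfact_succ (n : ℕ) : qfact (n + 1) = qfact n * qint (n + 1) :=
  Finset.prod_range_succ _ _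

theorem segPowM_mul_seg {n : ℤ} (hn : 0 ≤ n) : segPowM i j n * seg i j =
    (if i = -j then qint (2 * n + 2) else qint (n + 1)) • segPowM i j (n + 1) := by
  obtain ⟨n, rfl⟩ := Int.eq_ofNat_of_zero_le hn
  have h1 : qint ((n : ℤ) + 1) ≠ 0 := qint_ne_zero (by omega)
  have h2 : qint (2 * ((n : ℤ) + 1)) ≠ 0 := qint_ne_zero (by omega)
  have h3 := segPowM_natCast (i := i) (j := j) (n + 1)
  push_cast at h3
  rw [segPowM_natCast, h3, smul_mul_assoc, ← pow_succ, smul_smul]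
  congr 1
  split
  · rw [Finset.prod_range_succ, mul_inv, mul_left_comm, mul_add, mul_one] at *
    rw [mul_inv_cancel₀ h2, mul_one]
  · rw [qfact_succ, mul_inv, mul_left_comm, mul_inv_cancel₀ h1, mul_one]

theorem seg_mul_segPowM {n : ℤ} (hn : 0 ≤ n) : seg i j * segPowM i j n =
    (if i = -j then qint (2 * n + 2) else qint (n + 1)) • segPowM i j (n + 1) := by
  rw [← segPowM_mul_seg hn]
  exact commute_segPowM (Commute.refl _) n

theorem mul_segPowM {x z : U} (hij : i ≠ -j) (h : x * seg i j = q • (seg i j * x) + z)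
    (hz : QCommute q⁻¹ z (seg i j)) {n : ℤ} (hn : 0 ≤ n) :
    x * segPowM i j n = q ^ n • (segPowM i j n * x) + segPowM i j (n - 1) * z := by
  obtain ⟨n, rfl⟩ := Int.eq_ofNat_of_zero_le hn
  rcases n with _ | n
  · simp [segPowM_of_neg]
  · have h1 : qint ((n : ℤ) + 1) ≠ 0 := qint_ne_zero (by omega)
    rw [show ((n + 1 : ℕ) : ℤ) - 1 = n by push_cast; ring, segPowM_natCast, segPowM_natCast,
      if_neg hij, if_neg hij, mul_smul_comm, mul_pow_of_qcomm h hz, smul_add, smul_smul, smul_smul,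
      qfact_succ, mul_inv, inv_mul_cancel_right₀ h1, zpow_natCast, smul_mul_assoc,
      smul_mul_assoc, smul_smul, mul_comm (q ^ (n + 1))]

theorem segPowM_mul {x w : U} (hij : i ≠ -j) (h : seg i j * x = q • (x * seg i j) + w)
    (hw : QCommute q⁻¹ (seg i j) w) {n : ℤ} (hn : 0 ≤ n) :
    segPowM i j n * x = q ^ n • (x * segPowM i j n) + w * segPowM i j (n - 1) := by
  obtain ⟨n, rfl⟩ := Int.eq_ofNat_of_zero_le hn
  rcases n with _ | n
  · simp [segPowM_of_neg]
  · have h1 : qint ((n : ℤ) + 1) ≠ 0 := qint_ne_zero (by omega)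
    rw [show ((n + 1 : ℕ) : ℤ) - 1 = n by push_cast; ring, segPowM_natCast, segPowM_natCast,
      if_neg hij, if_neg hij, smul_mul_assoc, pow_mul_of_qcomm h hw, smul_add, smul_smul, smul_smul,
      qfact_succ, mul_inv, inv_mul_cancel_right₀ h1, zpow_natCast, mul_smul_comm,
      mul_smul_comm, smul_smul, mul_comm (q ^ (n + 1))]

end DividedPowers
section CyclicVector

variable {M : Type*} [AddCommGroup M] [Module K M] [Module U M] [IsScalarTower K U M] {v : M}
  {k : ℤ}

theorem seg_neg_smul
    (hv : ∀ k : ℤ, Odd k → fgen (-k) • v = fgen k • v) (n : ℕ) :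
    seg (-(2 * n + 1)) (-1) • v = seg 1 (2 * n + 1) • v := by
  induction n with
  | zero => simpa [seg_self] using hv 1 odd_one
  | succ n ih =>
    have hk : Odd (2 * ((n + 1 : ℕ) : ℤ) + 1) := odd_two_mul_add_one _
    have hk' : Odd (2 * (n : ℤ) + 1) := odd_two_mul_add_one _
    have h1 : Odd (-1 : ℤ) := by decide
    rw [seg_left hk.neg h1 (by push_cast; omega), seg_right odd_one hk (by push_cast; omega),
      show -(2 * ((n + 1 : ℕ) : ℤ) + 1) + 2 = -(2 * n + 1) by push_cast; ring,
      show 2 * ((n + 1 : ℕ) : ℤ) + 1 - 2 = 2 * n + 1 by push_cast; ring]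
    have c1 : Commute (fgen (-(2 * ((n + 1 : ℕ) : ℤ) + 1))) (seg 1 (2 * n + 1)) :=
      commute_fgen_seg_of_lt hk.neg odd_one (Or.inl (by push_cast; omega)) hk' (by omega)
    have c2 : Commute (fgen (2 * ((n + 1 : ℕ) : ℤ) + 1)) (seg (-(2 * n + 1)) (-1)) :=
      commute_fgen_seg_of_lt hk hk'.neg (Or.inr (by push_cast; omega)) h1 (by omega)
    rw [qcomm, qcomm, sub_smul, sub_smul, smul_assoc, smul_assoc, mul_smul, mul_smul, mul_smul, ih,
      hv _ hk, ← mul_smul, ← mul_smul, ← mul_smul, c1.eq, mul_smul, hv _ hk,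
      ← mul_smul, mul_smul (fgen (2 * ((n + 1 : ℕ) : ℤ) + 1)), ← ih, ← mul_smul, c2.eq, mul_smul,
      mul_smul]

theorem seg_neg_sub_two_smul
    (hv : ∀ k : ℤ, Odd k → fgen (-k) • v = fgen k • v) (hk : Odd k) (hk3 : 3 ≤ k) :
    seg (-k) (k - 2) • v = q⁻¹ • seg (-k + 2) k • v := by
  have h1 : Odd (-1 : ℤ) := by decide
  have hk2 : Odd (k - 2) := hk.sub_even even_two
  have hk2' : Odd (-k + 2) := hk.neg.add_even even_two
  have e1 : seg (-k) (-1) • v = seg 1 k • v := by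
    obtain ⟨a, rfl⟩ := hk
    obtain ⟨n, rfl⟩ := Int.eq_ofNat_of_zero_le (show 0 ≤ a by omega)
    exact seg_neg_smul hv n
  have e2 : seg (-k + 2) (-1) • v = seg 1 (k - 2) • v := by
    obtain ⟨a, ha⟩ := hk2
    obtain rfl : k = 2 * a + 3 := by omega
    obtain ⟨n, rfl⟩ := Int.eq_ofNat_of_zero_le (show 0 ≤ a by omega)
    convert seg_neg_smul hv n using 3
    ring
  have r1 : seg (-k) (-1) * seg (-k + 2) (-1) =
      q⁻¹ • (seg (-k + 2) (-1) * seg (-k) (-1)) :=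
    seg_seg_right hk.neg hk2' h1 (by omega) (by omega)
  have r2 : seg 1 (k - 2) * seg 1 k = q⁻¹ • (seg 1 k * seg 1 (k - 2)) :=
    seg_seg_left odd_one hk2 hk (by omega) (by omega)
  rw [seg_concat hk.neg hk2 h1 (by omega) (by omega), seg_concat hk2' hk h1 (by omega) (by omega)]
  norm_num only
  rw [qcomm, qcomm, sub_smul, sub_smul, smul_assoc, smul_assoc, mul_smul, ← e2, ← mul_smul, r1,
    mul_smul (seg 1 (k - 2)), e1, ← mul_smul, r2, smul_assoc, smul_assoc, mul_smul, e1,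
    mul_smul (seg 1 k), ← e2, smul_sub, mul_smul, mul_smul,
    smul_comm q q⁻¹]

/-- The action of `f_{-k}` on a vector `⟨-k+2,k-2⟩^{[n]} P φ̃`, for `P` commuting with the
relevant segments. -/
theorem fgen_neg_mul_segPowM_smul
    (hv : ∀ k : ℤ, Odd k → fgen (-k) • v = fgen k • v) (hk : Odd k) (hk3 : 3 ≤ k) {P : U}
    (h1 : Commute (fgen (-k)) P) (h2 : Commute (fgen k) P)
    (h3 : Commute (seg (-k) (k - 2)) P) (h4 : Commute (seg (-k + 2) k) P) {n : ℤ} (hn : 0 ≤ n) :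
    (fgen (-k) * (segPowM (-k + 2) (k - 2) n * P)) • v =
      q ^ (2 * n) • (fgen k * (segPowM (-k + 2) (k - 2) n * P)) • v +
      (seg (-k + 2) k * (segPowM (-k + 2) (k - 2) (n - 1) * P)) • v := by
  have hk2 : Odd (k - 2) := hk.sub_even even_two
  have hk2' : Odd (-k + 2) := hk.neg.add_even even_two
  have eP : (fgen (-k) * P) • v = (fgen k * P) • v := by
    rw [h1.eq, h2.eq, mul_smul, mul_smul, hv _ hk]
  have eZ : (seg (-k) (k - 2) * P) • v = q⁻¹ • (seg (-k + 2) k * P) • v := by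
    rw [h3.eq, h4.eq, mul_smul, mul_smul, seg_neg_sub_two_smul hv hk hk3, smul_comm]
  obtain ⟨n, rfl⟩ := Int.eq_ofNat_of_zero_le hn
  rcases n with _ | n
  · simp only [Nat.cast_zero, segPowM_zero, segPowM_of_neg, mul_zero, zpow_zero, one_mul, zero_mul,
      zero_smul, add_zero, zero_sub, Left.neg_neg_iff, zero_lt_one, eP]
    exact (one_smul K _).symm
  set Y := seg (-k + 2) (k - 2) with hY
  have c1 : fgen (-k) * Y = q • (Y * fgen (-k)) + seg (-k) (k - 2) := by
    rw [seg_left (i := -k) hk.neg hk2 (by omega), qcomm]; abel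
  have c2 : Y * fgen k = q • (fgen k * Y) + seg (-k + 2) k := by
    rw [seg_right (i := -k + 2) (j := k) hk2' hk (by omega), qcomm]; abel
  have c3 := mul_pow_of_qcomm c1 (seg_seg_right hk.neg hk2' hk2 (by omega) (by omega)) n
  have hYW := seg_seg_left hk2' hk2 hk (show -k + 2 ≤ k - 2 by omega) (by omega)
  have c4 := pow_mul_of_qcomm c2 hYW n
  have c5 : Y ^ n * seg (-k + 2) k = q ^ (-n : ℤ) • (seg (-k + 2) k * Y ^ n) := by
    have : QCommute (q⁻¹ ^ n) (Y ^ n) (seg (-k + 2) k) := by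
      clear c3 c4
      induction n with
      | zero => simp [QCommute]
      | succ n ih => rw [pow_succ q⁻¹, pow_succ]; exact (ih (by omega)).mul_left hYW
    rw [this, zpow_neg, zpow_natCast, inv_pow]
  have hq := qint_ne_zero (show 0 < 2 * ((n : ℤ) + 1) by omega)
  have key : (fgen (-k) * (Y ^ (n + 1) * P)) • v =
      q ^ (2 * ((n + 1 : ℕ) : ℤ)) • (fgen k * (Y ^ (n + 1) * P)) • v +
      qint (2 * ((n : ℤ) + 1)) • (seg (-k + 2) k * (Y ^ n * P)) • v := by
    rw [← mul_assoc, c3, add_mul, add_smul, smul_mul_assoc, smul_mul_assoc, smul_assoc,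
      smul_assoc, mul_assoc, mul_smul (Y ^ (n + 1)), eP, ← mul_smul, ← mul_assoc, c4, mul_assoc,
      mul_smul (Y ^ n), eZ, smul_comm (Y ^ n), ← mul_smul (Y ^ n), ← mul_assoc (Y ^ n), c5, add_mul,
      add_smul, smul_mul_assoc, smul_mul_assoc, smul_mul_assoc, smul_assoc, smul_assoc, smul_assoc,
      smul_add, add_assoc]
    simp only [smul_smul]
    rw [← add_smul, qint_two_mul]
    simp only [mul_assoc]
    congr 2
    · rw [two_mul, zpow_add₀ q_ne_zero, zpow_natCast]
    · rw [neg_add, zpow_add₀ q_ne_zero (-(n : ℤ)), zpow_neg_one]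
      rw [← zpow_natCast]
      push_cast
      ring
  have hs : -k + 2 = -(k - 2) := by ring
  rw [show ((n + 1 : ℕ) : ℤ) - 1 = n by push_cast; ring, segPowM_natCast, segPowM_natCast,
    if_pos hs, if_pos hs, Finset.prod_range_succ, ← hY]
  simp only [smul_mul_assoc, mul_smul_comm]
  rw [smul_assoc, smul_assoc, smul_assoc, key, smul_add, smul_smul, smul_smul, smul_smul,
    mul_comm (q ^ (2 * ((n + 1 : ℕ) : ℤ))), mul_inv, inv_mul_cancel_right₀ hq]

end CyclicVector
section Layers

variable {N : ℕ} {m m' : MS} {k : ℤ}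

/-- The part of the PBW product formed by the segments ending in `j`. -/
def layer (N : ℕ) (m : MS) (j : ℤ) : U :=
  descProd (fun i => segPowM i j (m (i, j))) (-N) (N + 1)

/-- The PBW product over all segments in the box `[-N, N]²`. -/
def pbwProd (N : ℕ) (m : MS) : U := descProd (layer N m) (-N) (N + 1)

/-- `m` is an integral combination of θ-restricted segments with right end at most `N`. -/
def IsThetaSpan (N : ℕ) (m : MS) : Prop :=
  ∀ i j : ℤ, m (i, j) ≠ 0 → Odd i ∧ Odd j ∧ -j ≤ i ∧ i ≤ j ∧ j ≤ N

theorem IsThetaSpan.zero : IsThetaSpan N 0 := fun _ _ h => (h rfl).elim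

theorem IsThetaSpan.add (hm : IsThetaSpan N m) (hm' : IsThetaSpan N m') :
    IsThetaSpan N (m + m') := fun i j h => by
  by_cases h0 : m (i, j) = 0
  · exact hm' i j fun h1 => h (by simp [h0, h1])
  · exact hm i j h0

theorem IsThetaSpan.sub (hm : IsThetaSpan N m) (hm' : IsThetaSpan N m') :
    IsThetaSpan N (m - m') := fun i j h => by
  by_cases h0 : m (i, j) = 0
  · exact hm' i j fun h1 => h (by simp [h0, h1])
  · exact hm i j h0

theorem sg_apply (i j a b : ℤ) : sg i j (a, b) = if a = i ∧ b = j then 1 else 0 := by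
  rw [sg, Finsupp.single_apply]
  exact if_congr (by rw [Prod.mk.injEq, eq_comm, eq_comm (a := j)]) rfl rfl

theorem isThetaSpan_sg {i j : ℤ} (hi : Odd i) (hj : Odd j) (h1 : -j ≤ i) (h2 : i ≤ j)
    (h3 : j ≤ N) : IsThetaSpan N (sg i j) := fun a b h => by
  rw [sg_apply] at h
  obtain ⟨rfl, rfl⟩ : a = i ∧ b = j := by by_contra h'; exact h (if_neg h')
  exact ⟨hi, hj, h1, h2, h3⟩

theorem natAbs_le_bound {i j : ℤ} (h : m (i, j) ≠ 0) :
    i.natAbs ≤ bound m ∧ j.natAbs ≤ bound m :=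
  max_le_iff.mp
    (Finset.le_sup (f := fun p : ℤ × ℤ => max p.1.natAbs p.2.natAbs)
      (Finsupp.mem_support_iff.mpr h))

theorem IsTheta.isThetaSpan (hm : IsTheta m) (h : bound m ≤ N) : IsThetaSpan N m :=
  fun i j hij => by
    obtain ⟨h1, h2, h3, h4, -⟩ := hm i j hij
    have := (natAbs_le_bound hij).2
    exact ⟨h1, h2, h3, h4, by omega⟩

theorem IsTheta.nonneg (hm : IsTheta m) (p : ℤ × ℤ) : 0 ≤ m p := by
  by_cases h : m p = 0
  · exact h.ge
  · exact (hm p.1 p.2 h).2.2.2.2.le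

theorem IsThetaSpan.bound_le (hm : IsThetaSpan N m) : bound m ≤ N := by
  refine Finset.sup_le fun p hp => ?_
  obtain ⟨-, -, h3, h4, h5⟩ := hm p.1 p.2 (Finsupp.mem_support_iff.mp hp)
  omega

theorem PthetaProd_eq_pbwProd_bound (m : MS) : PthetaProd m = pbwProd (bound m) m := by
  have key : ∀ (l : List ℤ) (f : ℤ → List (ℤ × ℤ)) (g : ℤ × ℤ → U),
      ((l.flatMap f).map g).prod = (l.map fun a => ((f a).map g).prod).prod := fun l f g => by
    induction l with
    | nil => rfl
    | cons a l ih => simp [ih]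
  have cast : ∀ l : List ℕ, (do let a ← l; pure (a : ℤ) : List ℤ) = l.map fun a : ℕ => (a : ℤ) :=
    fun l => by induction l with
      | nil => rfl
      | cons a l ih => simpa using ih
  rw [PthetaProd, box, key, cast, pbwProd, descProd,
    show ((bound m : ℤ) + 1 - -(bound m : ℤ)).toNat = 2 * bound m + 1 by omega, List.map_map]
  congr 1
  refine List.map_congr_left fun a _ => ?_
  simp only [Function.comp_apply]
  rw [layer, descProd, show ((bound m : ℤ) + 1 - -(bound m : ℤ)).toNat = 2 * bound m + 1 by omega,
    List.map_map, List.map_map]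
  congr 1
  refine List.map_congr_left fun b _ => ?_
  simp only [Function.comp_apply]
  ring_nf

theorem layer_eq_one {j : ℤ} (h : ∀ i, m (i, j) = 0) : layer N m j = 1 :=
  descProd_eq_one (by omega) fun i _ _ => by rw [h, segPowM_zero]

theorem layer_congr {j : ℤ} (h : ∀ i, m' (i, j) = m (i, j)) : layer N m' j = layer N m j :=
  descProd_congr (by omega) fun i _ _ => by rw [h]

theorem pbwProd_bound (h : bound m ≤ N) : pbwProd N m = pbwProd (bound m) m := by
  have h0 : ∀ i j, m (i, j) ≠ 0 → i.natAbs ≤ bound m ∧ j.natAbs ≤ bound m :=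
    fun i j => natAbs_le_bound
  rw [pbwProd, descProd_eq_of_eq_one_outside (a' := -bound m) (b' := bound m + 1) _ (by omega)
    (by omega) (by omega) fun j _ _ hj => layer_eq_one fun i => ?_]
  · refine descProd_congr (by omega) fun j _ _ => ?_
    refine descProd_eq_of_eq_one_outside _ (by omega) (by omega) (by omega) fun i _ _ hi => ?_
    have : m (i, j) = 0 := by
      by_contra hne
      have := h0 i j hne
      omega
    rw [this, segPowM_zero]
  · by_contra hne
    have := h0 i j hne
    omega

theorem Ptheta_eq_pbwProd (hm : IsThetaSpan N m) : Ptheta m = pbwProd N m := by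
  rw [Ptheta]
  split_ifs with h
  · rw [PthetaProd_eq_pbwProd_bound, pbwProd_bound hm.bound_le]
  · rw [IsTheta] at h
    push Not at h
    obtain ⟨i, j, hij, h'⟩ := h
    obtain ⟨h1, h2, h3, h4, h5⟩ := hm i j hij
    have hneg : m (i, j) < 0 := lt_of_le_of_ne (h' h1 h2 h3 h4) hij
    refine (descProd_eq_zero (c := j) (by omega) (by omega) ?_).symm
    refine descProd_eq_zero (c := i) (by omega) (by omega) ?_
    rw [segPowM_of_neg hneg]

theorem pbwProd_split {l : ℤ} (h1 : -N ≤ l) (h2 : l ≤ N)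
    (h : ∀ i j, j ≠ l → m' (i, j) = m (i, j)) :
    pbwProd N m' = descProd (layer N m) (l + 1) (N + 1) * layer N m' l *
      descProd (layer N m) (-N) l := by
  rw [pbwProd, descProd_split _ h1 (by omega)]
  congr 1
  · congr 1
    exact descProd_congr (by omega) fun j _ _ => layer_congr fun i => h i j (by omega)
  · exact descProd_congr (by omega) fun j _ _ => layer_congr fun i => h i j (by omega)

theorem sum_Ico_int_head {M : Type*} [AddCommMonoid M] (e : ℤ → M) {a b : ℤ} (hab : a < b) :
    ∑ i ∈ Finset.Ico a b, e i = e a + ∑ i ∈ Finset.Ico (a + 1) b, e i := by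
  rw [← Finset.insert_Ico_add_one_left_eq_Ico hab, Finset.sum_insert (by simp)]

/-- Absorbing a segment `⟨i,j⟩` into the layer of segments ending in `j`. -/
theorem layer_mul_seg (hm : IsThetaSpan N m) (hm0 : ∀ p, 0 ≤ m p) {i j : ℤ} (hi : Odd i)
    (hj : Odd j) (h1 : -j < i) (h2 : i ≤ j) (h3 : j ≤ N) (h : ∀ l, l ≠ i → m' (l, j) = m (l, j))
    (h' : m' (i, j) = m (i, j) + 1) :
    layer N m j * seg i j =
      (q ^ (-∑ l ∈ Finset.Ico (-j) i, m (l, j)) * qint (m (i, j) + 1)) • layer N m' j := by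
  have hlow : ∀ l, l < -j → m (l, j) = 0 := fun l hl => by
    by_contra hne
    have := hm l j hne
    omega
  have e1 : descProd (fun i => segPowM i j (m (i, j))) (-N) i =
      descProd (fun i => segPowM i j (m (i, j))) (-j) i :=
    descProd_eq_of_eq_one_outside _ (by omega) (by omega) le_rfl fun l _ _ hl => by
      rw [hlow l (by omega), segPowM_zero]
  have e2 : descProd (fun i => segPowM i j (m (i, j))) (-j) i * seg i j =
      q ^ (-∑ l ∈ Finset.Ico (-j) i, m (l, j)) •
        (seg i j * descProd (fun i => segPowM i j (m (i, j))) (-j) i) := by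
    rw [← Finset.sum_neg_distrib]
    refine descProd_qcommute q_ne_zero h1.le fun l hl1 hl2 => ?_
    by_cases hne : m (l, j) = 0
    · simp [hne, QCommute]
    · obtain ⟨hl, -, -, -, -⟩ := hm l j hne
      have := segPowM_qcommute (seg_seg_right hl hi hj hl2 h2) (m (l, j))
      rwa [inv_zpow, ← zpow_neg] at this
  rw [layer, layer, descProd_split _ (show -(N : ℤ) ≤ i by omega) (show i < (N : ℤ) + 1 by omega),
    descProd_split (fun i => segPowM i j (m' (i, j))) (show -(N : ℤ) ≤ i by omega)
    (show i < (N : ℤ) + 1 by omega),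
    descProd_congr (g := fun i => segPowM i j (m' (i, j)))
      (h := fun i => segPowM i j (m (i, j))) (a := i + 1) (by omega)
      fun l _ _ => by rw [h l (by omega)],
    descProd_congr (g := fun i => segPowM i j (m' (i, j)))
      (h := fun i => segPowM i j (m (i, j))) (b := i) (by omega)
      fun l _ _ => by rw [h l (by omega)],
    e1, mul_assoc, e2, h', mul_smul_comm, mul_smul, mul_assoc, ← mul_assoc (segPowM _ _ _),
    segPowM_mul_seg (hm0 _), if_neg (by omega), smul_mul_assoc, mul_smul_comm, mul_assoc]

theorem mul_pair_of_qcomm {F A : Type*} [Field F] [Ring A] [Algebra F A] {x B C Y Y' Z Z' z : A}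
    {α β γ : F} (hB : Commute x B) (hC : Commute x C) (hY : x * Y = α • (Y * x) + Y' * z)
    (hZ : x * Z = β • (Z * x)) (hz : z * Z = γ • Z') :
    x * (B * (Y * Z) * C) = (α * β) • (B * (Y * Z) * C * x) + γ • (B * (Y' * Z') * C) := by
  have e1 : x * (Y * Z) = (α * β) • (Y * Z * x) + γ • (Y' * Z') := by
    rw [← mul_assoc, hY, add_mul, smul_mul_assoc, mul_assoc, hZ, mul_assoc, hz, mul_smul_comm,
      smul_smul, mul_smul_comm, mul_assoc]
  rw [← mul_assoc, ← mul_assoc, hB.eq, mul_assoc B, e1, mul_add, add_mul, mul_smul_comm,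
    mul_smul_comm, smul_mul_assoc, smul_mul_assoc, mul_assoc _ C x, ← hC.eq]
  simp only [mul_assoc]

/-- Moving `f_{-k}` through the layer of segments ending in `j`, for `k ≤ j`. -/
theorem fgen_neg_mul_layer (hm : IsThetaSpan N m) (hm0 : ∀ p, 0 ≤ m p) (hk : Odd k) (hk0 : 0 < k)
    {j : ℤ} (hj : Odd j) (hkj : k ≤ j) (hjN : j ≤ N)
    (h : ∀ l, l ≠ -k → l ≠ -k + 2 → m' (l, j) = m (l, j))
    (h1 : m' (-k + 2, j) = m (-k + 2, j) - 1) (h2 : m' (-k, j) = m (-k, j) + 1) :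
    fgen (-k) * layer N m j =
      q ^ (m (-k + 2, j) - m (-k, j)) • (layer N m j * fgen (-k)) +
      (if k = j then qint (2 * m (-k, j) + 2) else qint (m (-k, j) + 1)) • layer N m' j := by
  have hk2 : Odd (-k + 2) := hk.neg.add_even even_two
  have heven : m (-k + 1, j) = 0 := by
    by_contra hne
    have h1 := (hm _ j hne).1
    exact (Int.not_even_iff_odd.mpr h1) (hk.neg.add_odd odd_one)
  have split : ∀ n : MS, n (-k + 1, j) = 0 → layer N n j =
      descProd (fun i => segPowM i j (n (i, j))) (-k + 3) (N + 1) *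
        (segPowM (-k + 2) j (n (-k + 2, j)) * segPowM (-k) j (n (-k, j))) *
        descProd (fun i => segPowM i j (n (i, j))) (-N) (-k) := fun n hn => by
    rw [layer, descProd_split _ (show -(N : ℤ) ≤ -k + 2 by omega) (by omega),
      descProd_split _ (show -(N : ℤ) ≤ -k by omega) (show -k < -k + 2 by omega),
      descProd_eq_one (a := -k + 1) (b := -k + 2) (by omega) fun i hi1 hi2 => by
        rw [show i = -k + 1 by omega, hn, segPowM_zero]]
    simp only [one_mul, mul_assoc, show -k + 2 + 1 = -k + 3 by ring]
  rw [split m heven, split m' (by rw [h _ (by omega) (by omega), heven]), h1, h2,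
    descProd_congr (g := fun i => segPowM i j (m' (i, j)))
      (h := fun i => segPowM i j (m (i, j))) (a := -k + 3) (by omega)
      fun l _ _ => by rw [h l (by omega) (by omega)],
    descProd_congr (g := fun i => segPowM i j (m' (i, j)))
      (h := fun i => segPowM i j (m (i, j))) (b := -k) (by omega)
      fun l _ _ => by rw [h l (by omega) (by omega)], sub_eq_add_neg, zpow_add₀ q_ne_zero]
  have comm : ∀ i, i < -k ∨ -k + 2 < i → Commute (fgen (-k)) (segPowM i j (m (i, j))) :=
    fun i hi => by
      by_cases hne : m (i, j) = 0
      · rw [hne, segPowM_zero]; exact Commute.one_right _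
      · obtain ⟨hio, -, -, hij, -⟩ := hm i j hne
        refine commute_segPowM ?_ _
        rcases hi with hi | hi
        · exact commute_fgen_seg_of_inner hk.neg hio hj hi (by omega)
        · exact commute_fgen_seg_of_lt hk.neg hio (Or.inl hi) hj hij
  refine mul_pair_of_qcomm (z := seg (-k) j)
    (commute_descProd (by omega) fun i _ _ => comm i (by omega))
    (commute_descProd (by omega) fun i _ _ => comm i (by omega)) ?_ ?_ ?_
  · refine mul_segPowM (by omega) ?_ (seg_seg_right hk.neg hk2 hj (by omega) (by omega)) (hm0 _)
    rw [seg_left (i := -k) hk.neg hj (by omega), qcomm]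
    abel
  · have := seg_seg_left hk.neg hk.neg hj le_rfl (show -k < j by omega)
    rw [seg_self] at this
    have := qcommute_segPowM this (m (-k, j))
    rwa [inv_zpow, ← zpow_neg] at this
  · rw [seg_mul_segPowM (hm0 _), if_congr (show -k = -j ↔ k = j by omega) rfl rfl]

end Layers

section LowerLayers

variable {M : Type*} [AddCommGroup M] [Module K M] [Module U M] [IsScalarTower K U M] {v : M}
  {N : ℕ} {m : MS} {k : ℤ}

theorem IsThetaSpan.eq_zero_of_not_odd (hm : IsThetaSpan N m) {i : ℤ} (hi : ¬ Odd i) (j : ℤ) :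
    m (i, j) = 0 := by
  by_contra h
  exact hi (hm i j h).1

theorem sub_sg_apply_of_ne {i j a b : ℤ} (h : a = i → b ≠ j) : (m - sg i j) (a, b) = m (a, b) := by
  rw [Finsupp.sub_apply, sg_apply, if_neg fun h' => h h'.1 h'.2, sub_zero]

theorem sub_sg_apply_self (i j : ℤ) : (m - sg i j) (i, j) = m (i, j) - 1 := by
  rw [Finsupp.sub_apply, sg_apply, if_pos ⟨rfl, rfl⟩]

theorem add_sg_apply_of_ne {i j a b : ℤ} (h : a = i → b ≠ j) : (m + sg i j) (a, b) = m (a, b) := by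
  rw [Finsupp.add_apply, sg_apply, if_neg fun h' => h h'.1 h'.2, add_zero]

theorem add_sg_apply_self (i j : ℤ) : (m + sg i j) (i, j) = m (i, j) + 1 := by
  rw [Finsupp.add_apply, sg_apply, if_pos ⟨rfl, rfl⟩]

/-- The lower part of the PBW product, with the segments ending in `k - 2` made explicit. -/
theorem descProd_layer_lower (hm : IsThetaSpan N m) (hk : Odd k) (hk3 : 3 ≤ k) (hkN : k ≤ N) :
    descProd (layer N m) (-N) k =
      descProd (fun i => segPowM i (k - 2) (m (i, k - 2))) (-k + 3) k *
        (segPowM (-k + 2) (k - 2) (m (-k + 2, k - 2)) * descProd (layer N m) (-N) (k - 2)) := by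
  have heven : layer N m (k - 1) = 1 := layer_eq_one fun i => by
    by_contra hne
    exact Int.not_odd_iff_even.mpr (hk.sub_odd odd_one) (hm _ _ hne).2.1
  rw [descProd_split _ (show -(N : ℤ) ≤ k - 2 by omega) (by omega),
    descProd_eq_one (a := k - 2 + 1) (by omega) fun i _ _ => by
      rw [show i = k - 1 by omega, heven], one_mul, ← mul_assoc]
  congr 1
  rw [layer, descProd_eq_of_eq_one_outside (a' := -k + 2) (b' := k) _ (by omega) (by omega)
    (by omega) fun i _ _ hi => ?_, descProd_split _ le_rfl (by omega), descProd_self, mul_one,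
    show -k + 2 + 1 = -k + 3 by ring]
  rw [show m (i, k - 2) = 0 by
    by_contra hne
    have := hm _ _ hne
    omega, segPowM_zero]

theorem mul_mul_smul_of_commute {x y z Q R R' : U} {a : K} (hx : Commute x Q) (hz : Commute z Q)
    (h : (x * R) • v = a • (y * R) • v + (z * R') • v) :
    (x * (Q * R)) • v = a • (Q * y * R) • v + (z * (Q * R')) • v := by
  rw [← mul_assoc, hx.eq, mul_assoc, mul_smul, h, smul_add, smul_comm Q a, ← mul_smul, ← mul_smul,
    ← mul_assoc Q z, ← hz.eq, mul_assoc, mul_assoc]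

/-- Moving `f_k` to the left of the product of the powers of `⟨i,k-2⟩` with `-k + 2 < i`. -/
theorem descProd_segPowM_mul_fgen (hm : IsThetaSpan N m) (hm0 : ∀ p, 0 ≤ m p) (hk : Odd k)
    (hk3 : 3 ≤ k) :
    descProd (fun i => segPowM i (k - 2) (m (i, k - 2))) (-k + 3) k * fgen k =
      q ^ (∑ i ∈ Finset.Ico (-k + 3) k, m (i, k - 2)) •
        (fgen k * descProd (fun i => segPowM i (k - 2) (m (i, k - 2))) (-k + 3) k) +
      ∑ l ∈ Finset.Ico (-k + 3) k, if Odd l then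
        q ^ (∑ i ∈ Finset.Ico (-k + 3) l, m (i, k - 2)) •
        (seg l k * descProd (fun i => segPowM i (k - 2) ((m - sg l (k - 2)) (i, k - 2))) (-k + 3) k)
        else 0 := by
  have hk2 : Odd (k - 2) := hk.sub_even even_two
  rw [descProd_mul q_ne_zero (e := fun i => m (i, k - 2))
    (h := fun l => if Odd l then seg l k * segPowM l (k - 2) (m (l, k - 2) - 1) else 0) (by omega)]
  · congr 1
    refine Finset.sum_congr rfl fun l hl => ?_
    obtain ⟨hl1, hl2⟩ := Finset.mem_Ico.mp hl
    split_ifs with hlo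
    · have comm : Commute (seg l k)
          (descProd (fun i => segPowM i (k - 2) (m (i, k - 2))) (l + 1) k) :=
        commute_descProd (by omega) fun i hi1 hi2 => by
          by_cases hne : m (i, k - 2) = 0
          · rw [hne, segPowM_zero]; exact Commute.one_right _
          · obtain ⟨hio, -, -, hij, -⟩ := hm _ _ hne
            exact commute_segPowM
              (commute_seg_of_nested hlo hio hk hk2 (by omega) hij (by omega)) _
      rw [descProd_split (fun i => segPowM i (k - 2) ((m - sg l (k - 2)) (i, k - 2))) hl1 hl2,
        ← mul_assoc, ← comm.eq, sub_sg_apply_self]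
      simp only [mul_assoc]
      congr 3
      · exact descProd_congr (by omega) fun i _ _ => by rw [sub_sg_apply_of_ne (by omega)]
      · congr 1
        exact descProd_congr (by omega) fun i _ _ => by rw [sub_sg_apply_of_ne (by omega)]
    · rw [mul_zero, zero_mul, smul_zero]
  · intro i hi1 hi2
    split_ifs with hio
    · have hik : i ≤ k - 2 := by
        obtain ⟨a, rfl⟩ := hio; obtain ⟨b, rfl⟩ := hk; omega
      refine segPowM_mul (by omega) ?_ (seg_seg_left hio hk2 hk hik (by omega)) (hm0 _)
      rw [seg_right (j := k) hio hk (by omega), qcomm]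
      abel
    · rw [hm.eq_zero_of_not_odd hio, segPowM_zero, zpow_zero, one_smul, one_mul, mul_one, add_zero]

/-- The action of `f_{-k}` on the lower part of the PBW product. -/
theorem fgen_neg_mul_descProd_layer_smul
    (hv : ∀ k : ℤ, Odd k → fgen (-k) • v = fgen k • v) (hm : IsThetaSpan N m)
    (hm0 : ∀ p, 0 ≤ m p) (hk : Odd k) (hk0 : 0 < k) (hkN : k ≤ N) :
    (fgen (-k) * descProd (layer N m) (-N) k) • v =
      (seg (-k + 2) k *
        descProd (layer N (m - if k ≠ 1 then sg (-k + 2) (k - 2) else 0)) (-N) k) • v +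
      ∑ i ∈ Finset.Ico (-k + 3) (k + 1), if Odd i then
        q ^ (2 * m (-k + 2, k - 2) + ∑ j ∈ Finset.Ico (-k + 3) i, m (j, k - 2)) •
        (seg i k * descProd (layer N (m - if i ≠ k then sg i (k - 2) else 0)) (-N) k) • v
        else 0 := by
  have hk2 : Odd (k - 2) := hk.sub_even even_two
  have hk2' : Odd (-k + 2) := hk.neg.add_even even_two
  rcases (show k = 1 ∨ 3 ≤ k by obtain ⟨a, rfl⟩ := hk; omega) with rfl | hk3
  · rw [if_neg (by omega), sub_zero,
      descProd_eq_one (by omega) fun j _ hj => layer_eq_one fun i => ?_,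
      show -1 + 2 = (1 : ℤ) by norm_num, seg_self]
    · simp [hv 1 odd_one]
    · by_contra hne
      obtain ⟨-, ⟨a, rfl⟩, h1, h2, -⟩ := hm _ _ hne
      omega
  have comm : ∀ x : U, (∀ i j, Odd i → Odd j → -j ≤ i → i ≤ j → j < k - 2 → Commute x (seg i j)) →
      Commute x (descProd (layer N m) (-N) (k - 2)) := fun x hx =>
    commute_descProd (by omega) fun j _ hj => commute_descProd (by omega) fun i _ _ => by
      by_cases hne : m (i, j) = 0
      · rw [hne, segPowM_zero]; exact Commute.one_right _
      · obtain ⟨hio, hjo, h1, h2, -⟩ := hm _ _ hne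
        exact commute_segPowM (hx i j hio hjo h1 h2 hj) _
  have comm' : ∀ x : U, (∀ i, Odd i → -k + 2 < i → i ≤ k - 2 → Commute x (seg i (k - 2))) →
      Commute x (descProd (fun i => segPowM i (k - 2) (m (i, k - 2))) (-k + 3) k) := fun x hx =>
    commute_descProd (by omega) fun i hi1 _ => by
      by_cases hne : m (i, k - 2) = 0
      · rw [hne, segPowM_zero]; exact Commute.one_right _
      · obtain ⟨hio, -, -, h2, -⟩ := hm _ _ hne
        exact commute_segPowM (hx i hio (by omega) h2) _
  have hsg : ∀ i, Odd i → -k + 2 ≤ i → i ≤ k - 2 → IsThetaSpan N (m - sg i (k - 2)) :=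
    fun i hi h1 h2 => hm.sub (isThetaSpan_sg hi hk2 (by omega) h2 (by omega))
  have low : ∀ i, descProd (layer N (m - sg i (k - 2))) (-N) (k - 2) =
      descProd (layer N m) (-N) (k - 2) := fun i =>
    descProd_congr (by omega) fun j _ _ => layer_congr fun l => sub_sg_apply_of_ne (by omega)
  have hlast := sum_Ico_int_succ (a := -k + 3) (b := k) (fun i => if Odd i then
        q ^ (2 * m (-k + 2, k - 2) + ∑ j ∈ Finset.Ico (-k + 3) i, m (j, k - 2)) •
        (seg i k * descProd (layer N (m - if i ≠ k then sg i (k - 2) else 0)) (-N) k) • v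
        else 0) (by omega)
  rw [hlast, if_pos (by omega), if_pos hk, if_neg (by omega), sub_zero,
    descProd_layer_lower hm hk hk3 hkN,
    mul_mul_smul_of_commute (comm' _ fun i hi h1 h2 =>
        commute_fgen_seg_of_lt hk.neg hi (Or.inl (by omega)) hk2 h2)
      (comm' _ fun i hi h1 h2 => commute_seg_of_nested hk2' hi hk hk2 h1 h2 (by omega))
      (fgen_neg_mul_segPowM_smul hv hk hk3
        (comm _ fun i j hi hj h1 h2 h3 =>
          commute_fgen_seg_of_lt hk.neg hi (Or.inl (by omega)) hj h2)
        (comm _ fun i j hi hj h1 h2 h3 => commute_fgen_seg_of_lt hk hi (Or.inr (by omega)) hj h2)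
        (comm _ fun i j hi hj h1 h2 h3 =>
          commute_seg_of_nested hk.neg hi hk2 hj (by omega) h2 (by omega))
        (comm _ fun i j hi hj h1 h2 h3 =>
          commute_seg_of_nested hk2' hi hk hj (by omega) h2 (by omega)) (hm0 _)),
    descProd_segPowM_mul_fgen hm hm0 hk hk3, add_comm]
  rw [descProd_layer_lower (hsg _ hk2' le_rfl (by omega)) hk hk3 hkN, sub_sg_apply_self, low,
    descProd_congr (g := fun i => segPowM i (k - 2) ((m - sg (-k + 2) (k - 2)) (i, k - 2)))
      (h := fun i => segPowM i (k - 2) (m (i, k - 2))) (b := k) (by omega)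
      fun i _ _ => by rw [sub_sg_apply_of_ne (by omega)]]
  congr 1
  rw [add_mul, add_smul, smul_add, add_comm, Finset.sum_mul, Finset.sum_smul, Finset.smul_sum]
  congr 1
  · refine Finset.sum_congr rfl fun i hi => ?_
    obtain ⟨hi1, hi2⟩ := Finset.mem_Ico.mp hi
    by_cases hio : Odd i
    · have hik : i ≤ k - 2 := by
        obtain ⟨a, rfl⟩ := hio; obtain ⟨b, rfl⟩ := hk; omega
      rw [if_pos hio, if_pos hio, if_pos (by omega),
        descProd_layer_lower (hsg _ hio (by omega) hik) hk hk3 hkN, low,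
        sub_sg_apply_of_ne (by omega), smul_mul_assoc, smul_assoc, smul_smul, zpow_add₀ q_ne_zero,
        mul_assoc]
    · rw [if_neg hio, if_neg hio, zero_mul, zero_smul, smul_zero]
  · rw [seg_self, smul_mul_assoc, smul_assoc, smul_smul, zpow_add₀ q_ne_zero, mul_assoc]

end LowerLayers

section Action

variable {M : Type*} [AddCommGroup M] [Module K M] [Module U M] [IsScalarTower K U M] {v : M}
  {N : ℕ} {m d : MS} {k : ℤ}

/-- Moving `f_{-k}` through the layers of segments ending in `j ≥ k`. -/
theorem fgen_neg_mul_pbwProd (hm : IsThetaSpan N m) (hm0 : ∀ p, 0 ≤ m p) (hk : Odd k) (hk0 : 0 < k)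
    (hkN : k ≤ N) :
    fgen (-k) * pbwProd N m =
      q ^ (∑ j ∈ Finset.Ico k (N + 1), (m (-k + 2, j) - m (-k, j))) •
        (descProd (layer N m) k (N + 1) * (fgen (-k) * descProd (layer N m) (-N) k)) +
      ∑ l ∈ Finset.Ico k (N + 1), if Odd l then
        ((if k = l then qint (2 * m (-k, l) + 2) else qint (m (-k, l) + 1)) *
          q ^ (∑ j ∈ Finset.Ico (l + 1) (N + 1), (m (-k + 2, j) - m (-k, j)))) •
        pbwProd N (m - sg (-k + 2) l + sg (-k) l) else 0 := by
  rw [pbwProd, ← descProd_mul_descProd (layer N m) (show -(N : ℤ) ≤ k by omega)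
      (show k ≤ (N : ℤ) + 1 by omega), ← mul_assoc,
    mul_descProd q_ne_zero (a := k) (e := fun j => m (-k + 2, j) - m (-k, j))
      (h := fun l => if Odd l then
        (if k = l then qint (2 * m (-k, l) + 2) else qint (m (-k, l) + 1)) •
          layer N (m - sg (-k + 2) l + sg (-k) l) l else 0) (by omega), add_mul, smul_mul_assoc,
    mul_assoc, Finset.sum_mul]
  · congr 1
    refine Finset.sum_congr rfl fun l hl => ?_
    obtain ⟨hl1, hl2⟩ := Finset.mem_Ico.mp hl
    by_cases hlo : Odd l
    · rw [if_pos hlo, if_pos hlo, pbwProd_split (m := m) (l := l) (by omega) (by omega) fun i j hj => by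
          rw [add_sg_apply_of_ne (by omega), sub_sg_apply_of_ne (by omega)],
        ← descProd_mul_descProd (layer N m) (show -(N : ℤ) ≤ k by omega) hl1, mul_smul_comm,
        smul_mul_assoc, smul_mul_assoc, smul_mul_assoc, smul_smul, mul_comm (ite _ _ _)]
      simp only [mul_assoc]
    · rw [if_neg hlo, if_neg hlo, mul_zero, zero_mul, smul_zero, zero_mul]
  · intro j hj1 hj2
    by_cases hjo : Odd j
    · rw [if_pos hjo]
      refine fgen_neg_mul_layer hm hm0 hk hk0 hjo hj1 (by omega) (fun l h1 h2 => ?_) ?_ ?_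
      · rw [add_sg_apply_of_ne (by omega), sub_sg_apply_of_ne (by omega)]
      · rw [add_sg_apply_of_ne (by omega), sub_sg_apply_self]
      · rw [add_sg_apply_self, sub_sg_apply_of_ne (by omega)]
    · have h0 : ∀ i, m (i, j) = 0 := fun i => by
        by_contra hne
        exact hjo (hm _ _ hne).2.1
      rw [if_neg hjo, layer_eq_one h0, h0, h0, sub_zero, zpow_zero, one_smul, one_mul, mul_one,
        add_zero]

/-- Absorbing a segment ending in `k` into the PBW product. -/
theorem descProd_layer_mul_seg_mul (hm : IsThetaSpan N m) (hm0 : ∀ p, 0 ≤ m p) {i : ℤ} (hi : Odd i)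
    (hk : Odd k) (h1 : -k < i) (h2 : i ≤ k) (h3 : k ≤ N) (hd : ∀ i j, k ≤ j → d (i, j) = 0) :
    descProd (layer N m) k (N + 1) * (seg i k * descProd (layer N (m - d)) (-N) k) =
      (qint (m (i, k) + 1) * q ^ (-∑ l ∈ Finset.Ico (-k) i, m (l, k))) •
        pbwProd N (m - d + sg i k) := by
  have hd' : ∀ i j, k ≤ j → (m - d) (i, j) = m (i, j) := fun i j hj => by
    rw [Finsupp.sub_apply, hd i j hj, sub_zero]
  rw [descProd_split _ le_rfl (by omega), descProd_self, mul_one, mul_assoc, ← mul_assoc _ (seg i k),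
    layer_mul_seg hm hm0 (m' := m - d + sg i k) hi hk h1 h2 h3
      (fun l hl => by rw [add_sg_apply_of_ne (by omega), hd' _ _ le_rfl])
      (by rw [add_sg_apply_self, hd' _ _ le_rfl]),
    pbwProd_split (m := m - d) (l := k) (by omega) h3 fun i j hj => add_sg_apply_of_ne (by omega),
    smul_mul_assoc, mul_smul_comm, mul_comm (qint _), mul_assoc,
    descProd_congr (g := layer N (m - d)) (a := k + 1) (by omega)
      fun j hj _ => layer_congr fun i => hd' i j (by omega)]

/-- The action of `f_{-k}` on a PBW vector, in terms of PBW products over the box `[-N, N]²`. -/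
theorem fgen_neg_mul_pbwProd_smul
    (hv : ∀ k : ℤ, Odd k → fgen (-k) • v = fgen k • v) (hm : IsThetaSpan N m)
    (hm0 : ∀ p, 0 ≤ m p) (hk : Odd k) (hk0 : 0 < k) (hkN : k ≤ N) {E : ℤ → ℤ}
    (hE : ∀ l, E l = ∑ j ∈ Finset.Ico (l + 1) (N + 1), (m (-k + 2, j) - m (-k, j))) :
    (fgen (-k) * pbwProd N m) • v =
      (∑ l ∈ Finset.Ico (k + 1) (N + 1), if Odd l then
        (qint (m (-k, l) + 1) * q ^ E l) • (pbwProd N (m - sg (-k + 2) l + sg (-k) l) • v)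
        else 0) +
      (qint (2 * m (-k, k) + 2) * q ^ E k) • (pbwProd N (m - sg (-k + 2) k + sg (-k) k) • v) +
      (qint (m (-k + 2, k) + 1) * q ^ (E k + m (-k + 2, k) - 2 * m (-k, k))) •
        (pbwProd N (m - (if k ≠ 1 then sg (-k + 2) (k - 2) else 0) + sg (-k + 2) k) • v) +
      ∑ i ∈ Finset.Ico (-k + 3) (k + 1), if Odd i then
        (qint (m (i, k) + 1) * q ^ (E k + 2 * m (-k + 2, k - 2) - 2 * m (-k, k) +
          ∑ j ∈ Finset.Ico (-k + 3) i, (m (j, k - 2) - m (j, k)))) •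
        (pbwProd N (m - (if i ≠ k then sg i (k - 2) else 0) + sg i k) • v) else 0 := by
  have hk2' : Odd (-k + 2) := hk.neg.add_even even_two
  have hd : ∀ (p : Prop) [Decidable p] (a i j : ℤ), k ≤ j →
      (if p then sg a (k - 2) else 0) (i, j) = 0 := fun p _ a i j hj => by
    split_ifs
    · rw [sg_apply, if_neg (by omega)]
    · rfl
  have hsum : ∀ i, -k + 3 ≤ i → ∑ l ∈ Finset.Ico (-k) i, m (l, k) =
      m (-k, k) + m (-k + 2, k) + ∑ l ∈ Finset.Ico (-k + 3) i, m (l, k) := fun i hi => by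
    rw [sum_Ico_int_head _ (by omega), sum_Ico_int_head _ (by omega),
      sum_Ico_int_head _ (by omega), show -k + 1 + 1 = -k + 2 by ring,
      show -k + 2 + 1 = -k + 3 by ring, hm.eq_zero_of_not_odd
      (Int.not_odd_iff_even.mpr (hk.neg.add_odd odd_one))]
    ring
  have hsum0 : ∑ l ∈ Finset.Ico (-k) (-k + 2), m (l, k) = m (-k, k) := by
    have := hsum (-k + 3) le_rfl
    rw [show -k + 3 = -k + 2 + 1 by ring, sum_Ico_int_succ _ (by omega), Finset.Ico_self,
      Finset.sum_empty] at this
    linarith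
  have hE' : ∑ j ∈ Finset.Ico k (N + 1 : ℤ), (m (-k + 2, j) - m (-k, j)) =
      m (-k + 2, k) - m (-k, k) + E k := by
    rw [hE, sum_Ico_int_head _ (by omega)]
  have hhead := sum_Ico_int_head (a := k) (b := N + 1) (fun l => if Odd l then
        ((if k = l then qint (2 * m (-k, l) + 2) else qint (m (-k, l) + 1)) *
          q ^ (∑ j ∈ Finset.Ico (l + 1) (N + 1 : ℤ), (m (-k + 2, j) - m (-k, j)))) •
        pbwProd N (m - sg (-k + 2) l + sg (-k) l) else 0) (by omega)
  rw [fgen_neg_mul_pbwProd hm hm0 hk hk0 hkN, hhead, if_pos hk, if_pos rfl, ← hE, hE', add_smul,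
    add_smul, smul_assoc, mul_smul (descProd _ _ _),
    fgen_neg_mul_descProd_layer_smul hv hm hm0 hk hk0 hkN, smul_add, ← mul_smul,
    descProd_layer_mul_seg_mul hm hm0 hk2' hk (by omega) (by omega) hkN (hd _ _), hsum0, smul_assoc,
    smul_assoc, smul_add, smul_smul]
  have e4 : q ^ (m (-k + 2, k) - m (-k, k) + E k) • descProd (layer N m) k (N + 1) •
      (∑ i ∈ Finset.Ico (-k + 3) (k + 1), if Odd i then
        q ^ (2 * m (-k + 2, k - 2) + ∑ j ∈ Finset.Ico (-k + 3) i, m (j, k - 2)) •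
        (seg i k * descProd (layer N (m - if i ≠ k then sg i (k - 2) else 0)) (-N) k) • v
        else 0) = ∑ i ∈ Finset.Ico (-k + 3) (k + 1), if Odd i then
        (qint (m (i, k) + 1) * q ^ (E k + 2 * m (-k + 2, k - 2) - 2 * m (-k, k) +
          ∑ j ∈ Finset.Ico (-k + 3) i, (m (j, k - 2) - m (j, k)))) •
        (pbwProd N (m - (if i ≠ k then sg i (k - 2) else 0) + sg i k) • v) else 0 := by
    rw [Finset.smul_sum, Finset.smul_sum]
    refine Finset.sum_congr rfl fun i hi => ?_
    obtain ⟨hi1, hi2⟩ := Finset.mem_Ico.mp hi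
    by_cases hio : Odd i
    · rw [if_pos hio, if_pos hio, smul_comm (descProd _ _ _) (q ^ _), ← mul_smul (descProd _ _ _),
        descProd_layer_mul_seg_mul hm hm0 hio hk (by omega) (by omega) hkN (hd _ _),
        hsum i hi1, smul_assoc, smul_smul, smul_smul, Finset.sum_sub_distrib]
      congr 1
      rw [mul_comm, mul_assoc, ← zpow_add₀ q_ne_zero, ← zpow_add₀ q_ne_zero]
      congr 2
      ring
    · rw [if_neg hio, if_neg hio, smul_zero, smul_zero]
  have e1 : (∑ l ∈ Finset.Ico (k + 1) (N + 1 : ℤ), if Odd l then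
        ((if k = l then qint (2 * m (-k, l) + 2) else qint (m (-k, l) + 1)) *
          q ^ (∑ j ∈ Finset.Ico (l + 1) (N + 1 : ℤ), (m (-k + 2, j) - m (-k, j)))) •
        pbwProd N (m - sg (-k + 2) l + sg (-k) l) else 0) • v =
      ∑ l ∈ Finset.Ico (k + 1) (N + 1 : ℤ), if Odd l then
        (qint (m (-k, l) + 1) * q ^ E l) • (pbwProd N (m - sg (-k + 2) l + sg (-k) l) • v)
        else 0 := by
    rw [Finset.sum_smul]
    refine Finset.sum_congr rfl fun l hl => ?_
    obtain ⟨hl1, hl2⟩ := Finset.mem_Ico.mp hl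
    rw [ite_smul, zero_smul, if_neg (show k ≠ l by omega), smul_assoc, hE]
  rw [e4, e1, show q ^ (m (-k + 2, k) - m (-k, k) + E k) *
      (qint (m (-k + 2, k) + 1) * q ^ (-m (-k, k))) =
      qint (m (-k + 2, k) + 1) * q ^ (E k + m (-k + 2, k) - 2 * m (-k, k)) by
    rw [mul_comm, mul_assoc, ← zpow_add₀ q_ne_zero]
    congr 2
    ring]
  abel

theorem finsum_ite_eq_sum {ι A : Type*} [AddCommMonoid A] {P : ι → Prop} [DecidablePred P]
    {f g : ι → A} {s : Finset ι} (h : ∀ x, P x → x ∉ s → f x = 0)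
    (h' : ∀ x ∈ s, (if P x then f x else 0) = g x) :
    ∑ᶠ x, (if P x then f x else 0) = ∑ x ∈ s, g x := by
  rw [finsum_eq_sum_of_support_subset (s := s), Finset.sum_congr rfl h']
  intro x hx
  by_contra hxs
  by_cases hP : P x
  · exact hx ((if_pos hP).trans (h x hP hxs))
  · exact hx (if_neg hP)

theorem fgen_neg_mul_Ptheta_smul (hv : ∀ k : ℤ, Odd k → fgen (-k) • v = fgen k • v) (hk : Odd k)
    (hk0 : 0 < k) (hm : IsTheta m) :
    (fgen (-k) * Ptheta m) • v =
      (∑ᶠ l : ℤ, if Odd l ∧ k < l then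
        (qint (m (-k, l) + 1) *
          q ^ (∑ᶠ l' : ℤ, if Odd l' ∧ l < l' then m (-k + 2, l') - m (-k, l') else 0)) •
          (Ptheta (m - sg (-k + 2) l + sg (-k) l) • v)
       else 0)
      + (qint (2 * m (-k, k) + 2) *
          q ^ (∑ᶠ l' : ℤ, if Odd l' ∧ k < l' then m (-k + 2, l') - m (-k, l') else 0)) •
          (Ptheta (m - sg (-k + 2) k + sg (-k) k) • v)
      + (qint (m (-k + 2, k) + 1) *
          q ^ ((∑ᶠ l' : ℤ, if Odd l' ∧ k < l' then m (-k + 2, l') - m (-k, l') else 0)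
               + m (-k + 2, k) - 2 * m (-k, k))) •
          (Ptheta (m - (if k ≠ 1 then sg (-k + 2) (k - 2) else 0) + sg (-k + 2) k) • v)
      + (∑ᶠ i : ℤ, if Odd i ∧ -k + 2 < i ∧ i ≤ k then
          (qint (m (i, k) + 1) *
            q ^ ((∑ᶠ l' : ℤ, if Odd l' ∧ k < l' then m (-k + 2, l') - m (-k, l') else 0)
                 + 2 * m (-k + 2, k - 2) - 2 * m (-k, k)
                 + (∑ᶠ j : ℤ, if Odd j ∧ -k + 2 < j ∧ j < i then
                      m (j, k - 2) - m (j, k) else 0))) •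
            (Ptheta (m - (if i ≠ k then sg i (k - 2) else 0) + sg i k) • v)
         else 0) := by
  set N := bound m + k.natAbs with hN
  have hkN : k ≤ N := by omega
  have hmN : IsThetaSpan N m := hm.isThetaSpan (by omega)
  have hk2 : Odd (k - 2) := hk.sub_even even_two
  have hk2' : Odd (-k + 2) := hk.neg.add_even even_two
  have hlarge : ∀ i j, (N : ℤ) < j → m (i, j) = 0 := fun i j hj => by
    by_contra hne
    have := hmN _ _ hne
    omega
  have hright : ∀ i j, ¬ Odd j → m (i, j) = 0 := fun i j hj => by
    by_contra hne
    exact hj (hmN _ _ hne).2.1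
  have hE : ∀ l, (∑ᶠ l' : ℤ, if Odd l' ∧ l < l' then m (-k + 2, l') - m (-k, l') else 0) =
      ∑ j ∈ Finset.Ico (l + 1) (N + 1), (m (-k + 2, j) - m (-k, j)) := fun l => by
    refine finsum_ite_eq_sum (fun x hx hxs => ?_) fun x hx => ?_
    · rw [Finset.mem_Ico] at hxs
      rw [hlarge _ _ (by omega), hlarge _ _ (by omega), sub_zero]
    · rw [Finset.mem_Ico] at hx
      by_cases hxo : Odd x
      · rw [if_pos ⟨hxo, by omega⟩]
      · rw [if_neg fun h => hxo h.1, hright _ _ hxo, hright _ _ hxo, sub_zero]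
  have hF : ∀ i, (∑ᶠ j : ℤ, if Odd j ∧ -k + 2 < j ∧ j < i then m (j, k - 2) - m (j, k) else 0) =
      ∑ j ∈ Finset.Ico (-k + 3) i, (m (j, k - 2) - m (j, k)) := fun i => by
    refine finsum_ite_eq_sum (fun x hx hxs => ?_) fun x hx => ?_
    · rw [Finset.mem_Ico] at hxs
      omega
    · rw [Finset.mem_Ico] at hx
      by_cases hxo : Odd x
      · rw [if_pos ⟨hxo, by omega⟩]
      · rw [if_neg fun h => hxo h.1, hmN.eq_zero_of_not_odd hxo, hmN.eq_zero_of_not_odd hxo,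
          sub_zero]
  have span1 : ∀ l, Odd l → k ≤ l → l ≤ N → IsThetaSpan N (m - sg (-k + 2) l + sg (-k) l) :=
    fun l hl h1 h2 =>
      (hmN.sub (isThetaSpan_sg hk2' hl (by omega) (by omega) h2)).add
        (isThetaSpan_sg hk.neg hl (by omega) (by omega) h2)
  have span2 : ∀ (p : Prop) [Decidable p] (i : ℤ), Odd i → -k + 2 ≤ i → i ≤ k →
      (p → i ≤ k - 2) → IsThetaSpan N (m - (if p then sg i (k - 2) else 0) + sg i k) :=
    fun p _ i hi h1 h2 hp => by
      refine (hmN.sub ?_).add (isThetaSpan_sg hi hk (by omega) h2 hkN)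
      split_ifs with h
      · exact isThetaSpan_sg hi hk2 (by omega) (hp h) (by omega)
      · exact IsThetaSpan.zero
  rw [Ptheta_eq_pbwProd hmN, fgen_neg_mul_pbwProd_smul hv hmN hm.nonneg hk hk0 hkN hE,
    Ptheta_eq_pbwProd (span1 k hk le_rfl hkN),
    Ptheta_eq_pbwProd (span2 (k ≠ 1) (-k + 2) hk2' le_rfl (by omega)
      fun h => by obtain ⟨a, rfl⟩ := hk; omega)]
  congr 1
  · congr 2
    symm
    refine finsum_ite_eq_sum (fun x hx hxs => ?_) fun x hx => ?_
    · rw [Finset.mem_Ico] at hxs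
      have hneg : (m - sg (-k + 2) x + sg (-k) x) (-k + 2, x) = -1 := by
        rw [add_sg_apply_of_ne (by omega), sub_sg_apply_self, hlarge _ _ (by omega), zero_sub]
      rw [Ptheta, if_neg fun h => by linarith [h.nonneg (-k + 2, x)], zero_smul, smul_zero]
    · rw [Finset.mem_Ico] at hx
      by_cases hxo : Odd x
      · rw [if_pos ⟨hxo, by omega⟩, if_pos hxo,
          Ptheta_eq_pbwProd (span1 x hxo (by omega) (by omega))]
      · rw [if_neg fun h => hxo h.1, if_neg hxo]
  · symm
    refine finsum_ite_eq_sum (fun x hx hxs => ?_) fun x hx => ?_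
    · rw [Finset.mem_Ico] at hxs
      omega
    · rw [Finset.mem_Ico] at hx
      by_cases hxo : Odd x
      · rw [if_pos ⟨hxo, by omega⟩, if_pos hxo, hF,
          Ptheta_eq_pbwProd (span2 (x ≠ k) x hxo (by omega) (by omega)
            fun h => by obtain ⟨a, rfl⟩ := hk; obtain ⟨b, rfl⟩ := hxo; omega)]
      · rw [if_neg fun h => hxo h.1, if_neg hxo]

end Action

theorem fgen_neg_smul_phi {k : ℤ} (hk : Odd k) : fgen (-k) • phi = fgen k • phi := by
  refine ((Submodule.Quotient.eq Jideal).mpr ?_).symm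
  simp only [smul_eq_mul, mul_one]
  exact Ideal.subset_span ⟨k, hk, rfl⟩

/-- Theorem 3.21 of Enomoto–Kashiwara: the action of `F_{−k} = f_{−k}` on the
PBW basis vector `P_θ(m)φ̃`. -/
theorem F_neg_action_on_PBW (k : ℤ) (hk : Odd k) (hkpos : 0 < k)
    (m : MS) (hm : IsTheta m) :
    (fgen (-k) * Ptheta m) • phi =
      (∑ᶠ l : ℤ, if Odd l ∧ k < l then
        (qint (m (-k, l) + 1) *
          q ^ (∑ᶠ l' : ℤ, if Odd l' ∧ l < l' then m (-k + 2, l') - m (-k, l') else 0)) •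
          (Ptheta (m - sg (-k + 2) l + sg (-k) l) • phi)
       else 0)
      + (qint (2 * m (-k, k) + 2) *
          q ^ (∑ᶠ l' : ℤ, if Odd l' ∧ k < l' then m (-k + 2, l') - m (-k, l') else 0)) •
          (Ptheta (m - sg (-k + 2) k + sg (-k) k) • phi)
      + (qint (m (-k + 2, k) + 1) *
          q ^ ((∑ᶠ l' : ℤ, if Odd l' ∧ k < l' then m (-k + 2, l') - m (-k, l') else 0)
               + m (-k + 2, k) - 2 * m (-k, k))) •
          (Ptheta (m - (if k ≠ 1 then sg (-k + 2) (k - 2) else 0) + sg (-k + 2) k) • phi)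
      + (∑ᶠ i : ℤ, if Odd i ∧ -k + 2 < i ∧ i ≤ k then
          (qint (m (i, k) + 1) *
            q ^ ((∑ᶠ l' : ℤ, if Odd l' ∧ k < l' then m (-k + 2, l') - m (-k, l') else 0)
                 + 2 * m (-k + 2, k - 2) - 2 * m (-k, k)
                 + (∑ᶠ j : ℤ, if Odd j ∧ -k + 2 < j ∧ j < i then
                      m (j, k - 2) - m (j, k) else 0))) •
            (Ptheta (m - (if i ≠ k then sg i (k - 2) else 0) + sg i k) • phi)
         else 0) := by
  exact fgen_neg_mul_Ptheta_smul (fun _ => fgen_neg_smul_phi) hk hkpos hm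

end
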